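/- Hausdorff convergence of rescaled minimizers to the ball as the volume tends to zero: let n ≥ 2, α ∈ (0,n), r > 0. For every ε > 0 there exists m₀ > 0 such that for every m ∈ (0, m₀) and every bounded convex set Ẽ ⊆ ℝⁿ with |Ẽ| = 1 that minimizes the rescaled energy Per_r(F) + m^{(n+1−α)/n} Φ_α(F) among bounded convex sets F with |F| = 1, there exists x ∈ ℝⁿ with d_H(Ẽ, B(x)) < ε, where d_H denotes the Hausdorff distance and B(x) is the ball of volume 1 centered at x. -/

import Mathlib

open MeasureTheory Metric Set Filter Bornology
open scoped ENNReal NNReal Pointwise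

noncomputable section

/-- The set of points of Lebesgue density one of `E ⊆ ℝⁿ`. -/
def densityOnePoints (n : ℕ) (E : Set (EuclideanSpace ℝ (Fin n))) :
    Set (EuclideanSpace ℝ (Fin n)) :=
  {x | Tendsto (fun ρ : ℝ => volume (E ∩ ball x ρ) / volume (ball x ρ))
        (nhdsWithin 0 (Ioi 0)) (nhds 1)}

/-- Minkowski sum `A ⊕ B_r = ⋃_{x ∈ A} B_r(x)`. -/
def minkSum (n : ℕ) (r : ℝ) (A : Set (EuclideanSpace ℝ (Fin n))) :
    Set (EuclideanSpace ℝ (Fin n)) :=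
  ⋃ x ∈ A, ball x r

/-- The nonlocal Minkowski perimeter `Per_r(E) = (1/(2r)) |(∂E) ⊕ B_r|`, where `∂E`
is the topological boundary of the density-one representative of `E`. -/
def perR (n : ℕ) (r : ℝ) (E : Set (EuclideanSpace ℝ (Fin n))) : ℝ≥0∞ :=
  volume (minkSum n r (frontier (densityOnePoints n E))) / ENNReal.ofReal (2 * r)

/-- The inner set `E ⊖ B_r = E \ ((∂E) ⊕ B_r)` (for the density-one representative). -/
def minkSub (n : ℕ) (r : ℝ) (E : Set (EuclideanSpace ℝ (Fin n))) :
    Set (EuclideanSpace ℝ (Fin n)) :=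
  densityOnePoints n E \ minkSum n r (frontier (densityOnePoints n E))

/-- The Riesz energy `Φ_α(E) = ∫_E ∫_E |x-y|^{-α} dx dy`. -/
def rieszEnergy (n : ℕ) (α : ℝ) (E : Set (EuclideanSpace ℝ (Fin n))) : ℝ≥0∞ :=
  ∫⁻ x in E, ∫⁻ y in E, edist x y ^ (-α)

/-- The radius of the ball in `ℝⁿ` with unit volume. -/
def unitRadius (n : ℕ) : ℝ :=
  (volume (ball (0 : EuclideanSpace ℝ (Fin n)) 1)).toReal ^ (-(n : ℝ)⁻¹)

/-- A rigid motion of `ℝⁿ`: a rotation followed by a translation. -/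
def IsRigidMotion (n : ℕ) (g : EuclideanSpace ℝ (Fin n) → EuclideanSpace ℝ (Fin n)) : Prop :=
  ∃ (R : EuclideanSpace ℝ (Fin n) ≃ₗᵢ[ℝ] EuclideanSpace ℝ (Fin n))
    (v : EuclideanSpace ℝ (Fin n)),
    LinearMap.det (R.toLinearEquiv : EuclideanSpace ℝ (Fin n) →ₗ[ℝ] EuclideanSpace ℝ (Fin n)) = 1 ∧
    ∀ x, g x = R x + v

/-- The Prékopa–Leindler property of a measure space with a real vector space structure. -/
def PLProp (E : Type*) [AddCommGroup E] [Module ℝ E] [MeasureSpace E] : Prop :=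
  ∀ l : ℝ, 0 < l → l < 1 → ∀ f g h : E → ℝ≥0∞, Measurable f → Measurable g → Measurable h →
    (∀ x y, f x ^ (1 - l) * g y ^ l ≤ h ((1 - l) • x + l • y)) →
    (∫⁻ x, f x) ^ (1 - l) * (∫⁻ x, g x) ^ l ≤ ∫⁻ x, h x

theorem PLProp.prod {E F : Type*} [AddCommGroup E] [Module ℝ E] [MeasureSpace E]
    [AddCommGroup F] [Module ℝ F] [MeasureSpace F]
    [SFinite (volume : Measure E)] [SFinite (volume : Measure F)]
    (hE : PLProp E) (hF : PLProp F) : PLProp (E × F) := by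
  intro l h0 h1 f g h hf hg hh H
  rw [Measure.volume_eq_prod, lintegral_prod _ hf.aemeasurable, lintegral_prod _ hg.aemeasurable,
    lintegral_prod _ hh.aemeasurable]
  refine hE l h0 h1 _ _ _ hf.lintegral_prod_right' hg.lintegral_prod_right'
    hh.lintegral_prod_right' ?_
  intro x x'
  refine hF l h0 h1 _ _ _ (hf.comp measurable_prodMk_left) (hg.comp measurable_prodMk_left)
    (hh.comp measurable_prodMk_left) ?_
  intro y y'
  exact H (x, y) (x', y')

theorem PLProp.of_equiv {E F : Type*} [AddCommGroup E] [Module ℝ E] [MeasureSpace E]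
    [AddCommGroup F] [Module ℝ F] [MeasureSpace F] (e : E ≃ᵐ F)
    (hlin : ∀ (a b : ℝ) x y, e.symm (a • x + b • y) = a • e.symm x + b • e.symm y)
    (he : MeasurePreserving e volume volume) (hF : PLProp F) : PLProp E := by
  intro l h0 h1 f g h hf hg hh H
  have key : ∀ f : E → ℝ≥0∞, ∫⁻ x, f x = ∫⁻ y, f (e.symm y) := by
    intro f
    have := (he.symm e).lintegral_comp_emb e.symm.measurableEmbedding f
    exact this.symm
  rw [key f, key g, key h]
  refine hF l h0 h1 _ _ _ (hf.comp e.symm.measurable) (hg.comp e.symm.measurable)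
    (hh.comp e.symm.measurable) ?_
  intro x y
  rw [hlin]
  exact H _ _

/-- AM-GM in `ℝ≥0∞`. -/
theorem amgm_ennreal (l : ℝ) (h0 : 0 < l) (h1 : l < 1) (a b : ℝ≥0∞) :
    a ^ (1 - l) * b ^ l ≤ ENNReal.ofReal (1 - l) * a + ENNReal.ofReal l * b := by
  have h1' : 0 < 1 - l := by linarith
  by_cases ha : a = ∞
  · subst ha
    rw [ENNReal.mul_top (by simpa using h1), top_add]; exact le_top
  by_cases hb : b = ∞
  · subst hb
    rw [ENNReal.mul_top (by simpa using h0), add_top]; exact le_top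
  lift a to ℝ≥0 using ha
  lift b to ℝ≥0 using hb
  have := NNReal.geom_mean_le_arith_mean2_weighted (1 - l).toNNReal l.toNNReal a b (by
    rw [← Real.toNNReal_add h1'.le h0.le]; simp)
  rw [Real.coe_toNNReal _ h1'.le, Real.coe_toNNReal _ h0.le] at this
  rw [← ENNReal.coe_rpow_of_nonneg _ h1'.le, ← ENNReal.coe_rpow_of_nonneg _ h0.le,
    ENNReal.ofReal, ENNReal.ofReal]
  exact_mod_cast this

/-- One-dimensional Brunn–Minkowski for compact sets. -/
theorem bm_one_compact {A B : Set ℝ} (hA : IsCompact A) (hB : IsCompact B)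
    (hA' : A.Nonempty) (hB' : B.Nonempty) : volume A + volume B ≤ volume (A + B) := by
  obtain ⟨a, ha, haM⟩ := hA.exists_isGreatest hA'
  obtain ⟨b, hb, hbm⟩ := hB.exists_isLeast hB'
  have e1 : volume A = volume (b +ᵥ A) := (measure_vadd _ _ _).symm
  have e2 : volume B = volume (a +ᵥ B) := (measure_vadd _ _ _).symm
  have hm : NullMeasurableSet (a +ᵥ B) volume :=
    (hB.vadd a).measurableSet.nullMeasurableSet
  have hd : AEDisjoint volume (b +ᵥ A) (a +ᵥ B) := by
    refine measure_mono_null (t := {a + b}) ?_ (by simp)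
    rintro x ⟨⟨y, hy, rfl⟩, ⟨z, hz, hz'⟩⟩
    have := haM hy
    have := hbm hz
    simp only [vadd_eq_add] at *
    simp only [mem_singleton_iff]
    linarith
  rw [e1, e2, ← measure_union₀ hm hd]
  apply measure_mono
  rintro x (⟨y, hy, rfl⟩ | ⟨y, hy, rfl⟩)
  · exact ⟨y, hy, b, hb, by simp [add_comm]⟩
  · exact ⟨a, ha, y, hy, by simp⟩

theorem bm_one {A B : Set ℝ} (hA : MeasurableSet A) (hB : MeasurableSet B)
    (hA' : A.Nonempty) (hB' : B.Nonempty) : volume A + volume B ≤ volume (A + B) := by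
  obtain ⟨a, ha⟩ := hA'
  obtain ⟨b, hb⟩ := hB'
  have key : ∀ K ⊆ A, IsCompact K → ∀ L ⊆ B, IsCompact L → volume K + volume L ≤ volume (A + B) := by
    intro K hKA hK L hLB hL
    calc volume K + volume L ≤ volume (insert a K) + volume (insert b L) := by
          gcongr <;> exact subset_insert _ _
      _ ≤ volume (insert a K + insert b L) :=
          bm_one_compact (hK.insert a) (hL.insert b) (insert_nonempty _ _) (insert_nonempty _ _)
      _ ≤ _ := by
          gcongr
          · exact insert_subset ha hKA
          · exact insert_subset hb hLB
  have h1 : ∀ K ⊆ A, IsCompact K → volume K + volume B ≤ volume (A + B) := by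
    intro K hKA hK
    rw [hB.measure_eq_iSup_isCompact]
    rw [ENNReal.add_biSup' ⟨∅, by simp⟩]
    refine iSup₂_le fun L hL => ?_
    by_cases hL' : IsCompact L
    · simpa [hL'] using key K hKA hK L hL hL'
    · simpa [hL'] using key K hKA hK ∅ (by simp) (by simp)
  rw [hA.measure_eq_iSup_isCompact, ENNReal.biSup_add' ⟨∅, by simp⟩]
  refine iSup₂_le fun L hL => ?_
  by_cases hL' : IsCompact L
  · simpa [hL'] using h1 L hL hL'
  · simpa [hL'] using h1 ∅ (by simp) (by simp)

theorem layer_unit (F : ℝ → ℝ≥0∞) (hF : Measurable F) (hF1 : ∀ x, F x ≤ 1) :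
    ∫⁻ x, F x = ∫⁻ t in Ioo (0 : ℝ) 1, volume {x | ENNReal.ofReal t < F x} := by
  have hfin : ∀ x, F x ≠ ∞ := fun x => ((hF1 x).trans_lt ENNReal.one_lt_top).ne
  have h1 := lintegral_eq_lintegral_meas_lt (volume : Measure ℝ) (f := fun x => (F x).toReal)
    (ae_of_all _ fun x => ENNReal.toReal_nonneg) hF.ennreal_toReal.aemeasurable
  simp only [ENNReal.ofReal_toReal (hfin _)] at h1
  rw [h1, ← lintegral_indicator measurableSet_Ioi, ← lintegral_indicator measurableSet_Ioo]
  congr 1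
  ext t
  by_cases ht : 0 < t
  · by_cases ht1 : t < 1
    · rw [indicator_of_mem (show t ∈ Ioi (0 : ℝ) from ht), indicator_of_mem (show t ∈ Ioo (0 : ℝ) 1 from ⟨ht, ht1⟩)]
      congr 1
      ext x
      simp only [mem_ofPred_eq]
      rw [ENNReal.ofReal_lt_iff_lt_toReal ht.le (hfin x)]
    · rw [indicator_of_mem (show t ∈ Ioi (0 : ℝ) from ht), indicator_of_notMem (fun h => ht1 h.2)]
      convert measure_empty (μ := (volume : Measure ℝ))
      ext x
      simp only [mem_ofPred_eq, mem_empty_iff_false, iff_false, not_lt]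
      have : (F x).toReal ≤ 1 := by
        simpa using ENNReal.toReal_mono ENNReal.one_ne_top (hF1 x)
      linarith
  · rw [indicator_of_notMem (show t ∉ Ioi (0 : ℝ) from ht),
      indicator_of_notMem (show t ∉ Ioo (0 : ℝ) 1 from fun h => ht h.1)]

theorem pl_one_norm (l : ℝ) (h0 : 0 < l) (h1 : l < 1) (f g h : ℝ → ℝ≥0∞) (hf : Measurable f)
    (hg : Measurable g) (hh : Measurable h)
    (H : ∀ x y, f x ^ (1 - l) * g y ^ l ≤ h ((1 - l) • x + l • y))
    (hf1 : ∀ x, f x ≤ 1) (hg1 : ∀ x, g x ≤ 1)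
    (hf2 : ∀ t < 1, ∃ x, t < f x) (hg2 : ∀ t < 1, ∃ x, t < g x) :
    ENNReal.ofReal (1 - l) * (∫⁻ x, f x) + ENNReal.ofReal l * (∫⁻ x, g x) ≤ ∫⁻ x, h x := by
  have h1' : 0 < 1 - l := by linarith
  have e : ∫⁻ x, min (h x) 1 ≤ ∫⁻ x, h x := lintegral_mono fun x => min_le_left _ _
  refine le_trans ?_ e
  rw [layer_unit f hf hf1, layer_unit g hg hg1,
    layer_unit (fun x => min (h x) 1) (hh.min measurable_const) (fun x => min_le_right _ _)]
  have mono : ∀ φ : ℝ → ℝ≥0∞, Measurable fun t : ℝ => volume {x | ENNReal.ofReal t < φ x} := by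
    intro φ
    refine Antitone.measurable fun s t hst => measure_mono fun x hx => ?_
    exact (ENNReal.ofReal_le_ofReal hst).trans_lt hx
  rw [← lintegral_const_mul _ (mono f), ← lintegral_const_mul _ (mono g),
    ← lintegral_add_left ((mono f).const_mul _)]
  refine setLIntegral_mono' measurableSet_Ioo fun t ht => ?_
  set A := {x | ENNReal.ofReal t < f x}
  set B := {x | ENNReal.ofReal t < g x}
  have hA : MeasurableSet A := measurableSet_lt measurable_const hf
  have hB : MeasurableSet B := measurableSet_lt measurable_const hg
  have ht1 : ENNReal.ofReal t < 1 := by simpa using ht.2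
  have e1 : volume ((1 - l) • A) = ENNReal.ofReal (1 - l) * volume A := by
    rw [Measure.addHaar_smul]; simp [abs_of_pos h1']
  have e2 : volume (l • B) = ENNReal.ofReal l * volume B := by
    rw [Measure.addHaar_smul]; simp [abs_of_pos h0]
  rw [← e1, ← e2]
  refine (bm_one (hA.const_smul₀ _) (hB.const_smul₀ _) ?_ ?_).trans (measure_mono ?_)
  · exact Set.Nonempty.smul_set (hf2 _ ht1)
  · exact Set.Nonempty.smul_set (hg2 _ ht1)
  · rintro _ ⟨_, ⟨x, hx, rfl⟩, _, ⟨y, hy, rfl⟩, rfl⟩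
    simp only [mem_ofPred_eq, lt_min_iff]
    refine ⟨?_, ht1⟩
    refine lt_of_lt_of_le ?_ (H x y)
    have hp : (ENNReal.ofReal t) = (ENNReal.ofReal t) ^ (1 - l) * (ENNReal.ofReal t) ^ l := by
      rw [← ENNReal.rpow_add_of_nonneg _ _ h1'.le h0.le]; simp
    rw [hp]
    exact ENNReal.mul_lt_mul (ENNReal.rpow_lt_rpow hx h1') (ENNReal.rpow_lt_rpow hy h0)

theorem pl_one_bdd (l : ℝ) (h0 : 0 < l) (h1 : l < 1) (f g h : ℝ → ℝ≥0∞) (hf : Measurable f)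
    (hg : Measurable g) (hh : Measurable h)
    (H : ∀ x y, f x ^ (1 - l) * g y ^ l ≤ h ((1 - l) • x + l • y))
    (M N : ℝ≥0∞) (hM : M ≠ ∞) (hN : N ≠ ∞)
    (hf1 : ∀ x, f x ≤ M) (hg1 : ∀ x, g x ≤ N) :
    (∫⁻ x, f x) ^ (1 - l) * (∫⁻ x, g x) ^ l ≤ ∫⁻ x, h x := by
  have h1' : 0 < 1 - l := by linarith
  set a := ⨆ x, f x with ha
  set b := ⨆ x, g x with hb
  have haT : a ≠ ∞ := ((iSup_le hf1).trans_lt hM.lt_top).ne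
  have hbT : b ≠ ∞ := ((iSup_le hg1).trans_lt hN.lt_top).ne
  by_cases ha0 : a = 0
  · have : ∀ x, f x = 0 := by simpa [ha] using ha0
    simp [this, h1']
  by_cases hb0 : b = 0
  · have : ∀ x, g x = 0 := by simpa [hb] using hb0
    simp [this, h0]
  set c := a ^ (1 - l) * b ^ l with hc
  have hc0 : c ≠ 0 := by
    simp [hc, ENNReal.rpow_eq_zero_iff, ha0, hb0, haT, hbT]
  have hcT : c ≠ ∞ := ENNReal.mul_ne_top (ENNReal.rpow_ne_top_of_nonneg h1'.le haT)
    (ENNReal.rpow_ne_top_of_nonneg h0.le hbT)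
  have sup1 : ∀ (φ : ℝ → ℝ≥0∞) (s : ℝ≥0∞), s = (⨆ x, φ x) → s ≠ 0 → s ≠ ∞ →
      (∀ x, φ x / s ≤ 1) ∧ ∀ t < 1, ∃ x, t < φ x / s := by
    intro φ s hs h0 hT
    refine ⟨fun x => ENNReal.div_le_of_le_mul (by rw [one_mul, hs]; exact le_iSup φ x), ?_⟩
    intro t ht
    have : t * s < ⨆ x, φ x := by
      rw [← hs]
      calc t * s < 1 * s := (ENNReal.mul_lt_mul_iff_left h0 hT).2 ht
        _ = s := one_mul _
    obtain ⟨x, hx⟩ := lt_iSup_iff.1 this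
    exact ⟨x, (ENNReal.lt_div_iff_mul_lt (Or.inl h0) (Or.inl hT)).2 hx⟩
  obtain ⟨f1, f2⟩ := sup1 f a ha ha0 haT
  obtain ⟨g1, g2⟩ := sup1 g b hb hb0 hbT
  have := pl_one_norm l h0 h1 (fun x => f x / a) (fun x => g x / b) (fun x => h x / c)
    (hf.div_const _) (hg.div_const _) (hh.div_const _) (by
      intro x y
      rw [ENNReal.div_rpow_of_nonneg _ _ h1'.le, ENNReal.div_rpow_of_nonneg _ _ h0.le]
      rw [← ENNReal.mul_div_mul_comm]
      · exact ENNReal.div_le_div_right (H x y) _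
      · right; exact ENNReal.rpow_ne_top_of_nonneg h0.le hbT
      · left; exact ENNReal.rpow_ne_top_of_nonneg h1'.le haT) f1 g1 f2 g2
  have := (amgm_ennreal l h0 h1 _ _).trans this
  simp only [div_eq_mul_inv] at this
  rw [lintegral_mul_const _ hf, lintegral_mul_const _ hg, lintegral_mul_const _ hh,
    ← div_eq_mul_inv, ← div_eq_mul_inv, ← div_eq_mul_inv,
    ENNReal.div_rpow_of_nonneg _ _ h1'.le, ENNReal.div_rpow_of_nonneg _ _ h0.le,
    ← ENNReal.mul_div_mul_comm] at this
  · rwa [ENNReal.div_le_iff hc0 hcT, ENNReal.div_mul_cancel hc0 hcT] at this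
  · right; exact ENNReal.rpow_ne_top_of_nonneg h0.le hbT
  · left; exact ENNReal.rpow_ne_top_of_nonneg h1'.le haT

theorem pl_one : PLProp ℝ := by
  intro l h0 h1 f g h hf hg hh H
  have h1' : 0 < 1 - l := by linarith
  by_cases hf0 : ∫⁻ x, f x = 0
  · simp [hf0, h1']
  by_cases hg0 : ∫⁻ x, g x = 0
  · simp [hg0, h0]
  have tend : ∀ φ : ℝ → ℝ≥0∞, Measurable φ →
      Tendsto (fun k : ℕ => ∫⁻ x, min (φ x) k) atTop (nhds (∫⁻ x, φ x)) := by
    intro φ hφ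
    refine lintegral_tendsto_of_tendsto_of_monotone
      (fun k => (hφ.min measurable_const).aemeasurable) (ae_of_all _ fun x => ?_)
      (ae_of_all _ fun x => ?_)
    · intro i j hij
      exact min_le_min le_rfl (by exact_mod_cast hij)
    · have : Tendsto (fun k : ℕ => min (φ x) (k : ℝ≥0∞)) atTop (nhds (min (φ x) ∞)) :=
        tendsto_const_nhds.min ENNReal.tendsto_nat_nhds_top
      simpa using this
  have T1 := (tend f hf).ennrpow_const (1 - l)
  have T2 := (tend g hg).ennrpow_const l
  have T := ENNReal.Tendsto.mul T1 (Or.inl (by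
    simp [ENNReal.rpow_eq_zero_iff, hf0, h1.le])) T2 (Or.inl (by
    simp [ENNReal.rpow_eq_zero_iff, hg0, h0.le]))
  refine le_of_tendsto' T fun k => ?_
  refine pl_one_bdd l h0 h1 _ _ h (hf.min measurable_const) (hg.min measurable_const) hh ?_ k k
    (by simp) (by simp) (fun x => min_le_right _ _) (fun x => min_le_right _ _)
  intro x y
  refine le_trans ?_ (H x y)
  gcongr <;> exact min_le_left _ _

theorem pl_pi (n : ℕ) : PLProp (Fin n → ℝ) := by
  induction n with
  | zero =>
    intro l h0 h1 f g h hf hg hh H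
    rw [lintegral_unique, lintegral_unique, lintegral_unique]
    have : (volume : Measure (Fin 0 → ℝ)) univ = 1 := by simp [volume_pi]
    rw [this]
    simp only [mul_one]
    have := H default default
    convert this
  | succ n ih =>
    refine PLProp.of_equiv (MeasurableEquiv.piFinSuccAbove (fun _ : Fin (n + 1) => ℝ) 0) ?_
      (volume_preserving_piFinSuccAbove _ 0) (pl_one.prod ih)
    intro a b x y
    ext i
    refine Fin.cases ?_ (fun j => ?_) i
    · simp [MeasurableEquiv.piFinSuccAbove]
    · simp [MeasurableEquiv.piFinSuccAbove]

theorem pl_euclidean (n : ℕ) : PLProp (EuclideanSpace ℝ (Fin n)) := by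
  refine PLProp.of_equiv (MeasurableEquiv.toLp 2 (Fin n → ℝ)).symm ?_
    (EuclideanSpace.volume_preserving_symm_measurableEquiv_toLp (Fin n)) (pl_pi n)
  intro a b x y
  ext i
  simp

/-- Multiplicative Brunn–Minkowski. -/
theorem bm_mul {n : ℕ} {l : ℝ} (h0 : 0 < l) (h1 : l < 1) {A B M : Set (EuclideanSpace ℝ (Fin n))}
    (hA : MeasurableSet A) (hB : MeasurableSet B) (hM : MeasurableSet M)
    (H : ∀ x ∈ A, ∀ y ∈ B, (1 - l) • x + l • y ∈ M) :
    volume A ^ (1 - l) * volume B ^ l ≤ volume M := by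
  have h1' : 0 < 1 - l := by linarith
  have := pl_euclidean n l h0 h1 (A.indicator 1) (B.indicator 1) (M.indicator 1)
    (measurable_one.indicator hA) (measurable_one.indicator hB) (measurable_one.indicator hM) (by
      intro x y
      by_cases hx : x ∈ A
      · by_cases hy : y ∈ B
        · simp [hx, hy, H x hx y hy]
        · simp [hy, h0]
      · simp [hx, h1'])
  simpa [lintegral_indicator_one, hA, hB, hM] using this

/-- A log-concave distribution function of compact support. -/
structure LCdf (F : ℝ → ℝ) : Prop where
  mono : Monotone F
  cont : Continuous F
  nonneg : ∀ s, 0 ≤ F s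
  le_one : ∀ s, F s ≤ 1
  zero : ∃ a, F a = 0
  one : ∃ b, F b = 1
  lc : ∀ l, 0 < l → l < 1 → ∀ s t, F s ^ (1 - l) * F t ^ l ≤ F ((1 - l) * s + l * t)

namespace LCdf

variable {F G H : ℝ → ℝ}

theorem ex (hF : LCdf F) (p : ℝ) (h0 : 0 ≤ p) (h1 : p ≤ 1) : ∃ s, F s = p := by
  obtain ⟨a, ha⟩ := hF.zero
  obtain ⟨b, hb⟩ := hF.one
  have := mem_range_of_exists_le_of_exists_ge hF.cont (c := p) ⟨a, by linarith⟩ ⟨b, by linarith⟩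
  exact this

theorem rderiv (hF : LCdf F) (s : ℝ) (h0 : 0 < F s) (h1 : F s < 1) :
    ∃ f, 0 < f ∧ HasDerivWithinAt F f (Ioi s) s := by
  obtain ⟨b, hb⟩ := hF.one
  have hsb : s < b := by
    by_contra h
    have := hF.mono (not_lt.1 h)
    linarith
  set S : Set ℝ := {x | 0 < F x} with hS
  have hSo : IsOpen S := isOpen_lt continuous_const hF.cont
  have hSc : Convex ℝ S := by
    refine OrdConnected.convex ⟨fun x hx y hy z hz => ?_⟩
    exact lt_of_lt_of_le (show 0 < F x from hx) (hF.mono hz.1)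
  have hconc : ConcaveOn ℝ S (fun x => Real.log (F x)) := by
    refine ⟨hSc, fun x hx y hy a b ha hb hab => ?_⟩
    have hx' : 0 < F x := hx
    have hy' : 0 < F y := hy
    rcases ha.eq_or_lt with rfl | ha
    · obtain rfl : b = 1 := by linarith
      simp
    rcases hb.eq_or_lt with rfl | hb
    · obtain rfl : a = 1 := by linarith
      simp
    have := hF.lc b hb (by linarith) x y
    have e : 1 - b = a := by linarith
    rw [e] at this
    have h2 := Real.log_le_log (by positivity) this
    rw [Real.log_mul (by positivity) (by positivity), Real.log_rpow hx', Real.log_rpow hy'] at h2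
    simpa using h2
  have hsS : s ∈ S := h0
  have hcv := hconc.neg
  have hd := hcv.hasDerivWithinAt_rightDeriv_of_mem_interior (by rwa [hSo.interior_eq])
  have hsl := hcv.rightDeriv_le_slope_of_mem_interior (x := s) (y := b)
    (by rwa [hSo.interior_eq]) (by simp [hS, hb]) hsb
  set d := derivWithin (-fun x => Real.log (F x)) (Ioi s) s
  have hdneg : d < 0 := by
    refine lt_of_le_of_lt hsl ?_
    rw [slope_def_field]
    simp only [Pi.neg_apply, hb, Real.log_one]
    apply div_neg_of_neg_of_pos
    · have := Real.log_neg h0 h1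
      linarith
    · linarith
  have hd2 : HasDerivWithinAt (fun x => Real.log (F x)) (-d) (Ioi s) s := by
    have := hd.neg
    simpa using! this
  refine ⟨F s * (-d), by nlinarith, ?_⟩
  have h3 := hd2.exp
  rw [Real.exp_log h0] at h3
  refine h3.congr_of_eventuallyEq ?_ (Real.exp_log h0).symm
  filter_upwards [nhdsWithin_le_nhds (hSo.mem_nhds hsS)] with x hx
  exact (Real.exp_log hx).symm

theorem strict (hF : LCdf F) {s t : ℝ} (hst : s < t) (h0 : 0 < F t) (h1 : F s < 1) : F s < F t := by
  rcases (hF.nonneg s).eq_or_lt with h | h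
  · rwa [← h]
  obtain ⟨f, hf, hd⟩ := hF.rderiv s h h1
  rw [hasDerivWithinAt_iff_tendsto_slope' (by simp)] at hd
  have e1 := hd.eventually (lt_mem_nhds hf)
  have e2 : ∀ᶠ x in nhdsWithin s (Ioi s), x ∈ Ioo s t := Ioo_mem_nhdsGT hst
  obtain ⟨x, hx, hx'⟩ := (e1.and e2).exists
  rw [slope_def_field] at hx
  have hx1 : 0 < x - s := by linarith [hx'.1]
  have : 0 < F x - F s := by
    by_contra hcon
    have := div_nonpos_of_nonpos_of_nonneg (not_lt.1 hcon) hx1.le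
    linarith
  have := hF.mono hx'.2.le
  linarith

theorem lt_of_lt (hF : LCdf F) {s t : ℝ} (h : F s < F t) : s < t := by
  by_contra hc
  have := hF.mono (not_lt.1 hc)
  linarith

theorem eq_translate (hF : LCdf F) (hG : LCdf G) (l : ℝ) (hl0 : 0 < l) (hl1 : l < 1)
    (ha : ∀ s t, 0 < F s → F s < 1 → F s = G t → H ((1 - l) * s + l * t) = F s)
    (hb : ∀ s t δ, 0 < δ → (F (s + δ) - F s) ^ (1 - l) * (G (t + δ) - G t) ^ l ≤
      H ((1 - l) * s + l * t + δ) - H ((1 - l) * s + l * t)) :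
    ∃ c, ∀ s, F s = G (s + c) := by
  have hl1' : 0 < 1 - l := by linarith
  choose T hT using fun s => hG.ex (F s) (hF.nonneg s) (hF.le_one s)
  set U : Set ℝ := {s | 0 < F s ∧ F s < 1} with hU
  have hUo : IsOpen U := (isOpen_lt continuous_const hF.cont).inter
    (isOpen_lt hF.cont continuous_const)
  have hTmono : ∀ s ∈ U, ∀ t, s < t → T s < T t := by
    intro s hs t hst
    apply hG.lt_of_lt
    rw [hT, hT]
    exact hF.strict hst (lt_of_lt_of_le hs.1 (hF.mono hst.le)) hs.2
  have hTcont : ∀ s ∈ U, ContinuousAt T s := by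
    intro s hs
    rw [Metric.continuousAt_iff']
    intro ε hε
    have g1 : G (T s - ε) < F s := by
      rw [← hT s]
      apply hG.strict (by linarith) (by rw [hT]; exact hs.1)
      have := hG.mono (show T s - ε ≤ T s by linarith)
      rw [hT] at this
      linarith [hs.2]
    have g2 : F s < G (T s + ε) := by
      rw [← hT s]
      apply hG.strict (by linarith) _ (by rw [hT]; exact hs.2)
      have := hG.mono (show T s ≤ T s + ε by linarith)
      rw [hT] at this
      linarith [hs.1]
    filter_upwards [hF.cont.continuousAt.eventually (lt_mem_nhds g1),
      hF.cont.continuousAt.eventually (gt_mem_nhds g2)] with x hx1 hx2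
    rw [← hT x] at hx1 hx2
    have := hG.lt_of_lt hx1
    have := hG.lt_of_lt hx2
    rw [Real.dist_eq, abs_lt]
    constructor <;> linarith
  have hTder : ∀ s ∈ U, HasDerivWithinAt T 1 (Ioi s) s := by
    intro s hs
    obtain ⟨f, hf, hfd⟩ := hF.rderiv s hs.1 hs.2
    obtain ⟨g, hg, hgd⟩ := hG.rderiv (T s) (by rw [hT]; exact hs.1) (by rw [hT]; exact hs.2)
    rw [hasDerivWithinAt_iff_tendsto_slope' (by simp)] at hfd hgd
    have hTr : Tendsto T (nhdsWithin s (Ioi s)) (nhdsWithin (T s) (Ioi (T s))) := by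
      rw [tendsto_nhdsWithin_iff]
      refine ⟨(hTcont s hs).tendsto.mono_left nhdsWithin_le_nhds, ?_⟩
      filter_upwards [self_mem_nhdsWithin] with x hx
      exact hTmono s hs x hx
    have hTs : Tendsto (slope T s) (nhdsWithin s (Ioi s)) (nhds (f / g)) := by
      have := hfd.div (hgd.comp hTr) hg.ne'
      refine this.congr' ?_
      filter_upwards [self_mem_nhdsWithin] with x hx
      have h1 := hTmono s hs x hx
      have h2 : F s < F x := hF.strict hx (lt_of_lt_of_le hs.1 (hF.mono (le_of_lt hx))) hs.2
      have hx : s < x := hx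
      simp only [Pi.div_apply, Function.comp, slope_def_field, hT]
      have : x - s ≠ 0 := by linarith
      have : F x - F s ≠ 0 := by linarith
      have : T x - T s ≠ 0 := by linarith
      field_simp
    -- the increment
    set κ := (1 - l) + l * (f / g) with hκ
    have hκ0 : 0 < κ := by positivity
    set δ : ℝ → ℝ := fun x => (1 - l) * (x - s) + l * (T x - T s) with hδ
    have hδpos : ∀ x, s < x → 0 < δ x := by
      intro x hx
      have := hTmono s hs x hx
      have h1 : 0 < x - s := by linarith
      have h2 : 0 < T x - T s := by linarith
      simp only [hδ]; positivity
    have hδs : Tendsto (fun x => δ x / (x - s)) (nhdsWithin s (Ioi s)) (nhds κ) := by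
      have := (hTs.const_mul l).const_add (1 - l)
      refine this.congr' ?_
      filter_upwards [self_mem_nhdsWithin] with x hx
      have hx : s < x := hx
      have : x - s ≠ 0 := by linarith
      simp only [hδ, slope_def_field]
      field_simp
    have hδ0 : Tendsto δ (nhdsWithin s (Ioi s)) (nhds 0) := by
      have c1 : Tendsto (fun x : ℝ => x - s) (nhdsWithin s (Ioi s)) (nhds 0) := by
        have : Tendsto (fun x : ℝ => x - s) (nhds s) (nhds (s - s)) :=
          (continuous_id.sub continuous_const).tendsto s
        rw [sub_self] at this
        exact this.mono_left nhdsWithin_le_nhds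
      have c2 := hδs.mul c1
      rw [mul_zero] at c2
      refine c2.congr' ?_
      filter_upwards [self_mem_nhdsWithin] with x hx
      have hx : s < x := hx
      have : x - s ≠ 0 := by linarith
      field_simp
    have hshift : ∀ a : ℝ, Tendsto (fun x => a + δ x) (nhdsWithin s (Ioi s))
        (nhdsWithin a (Ioi a)) := by
      intro a
      rw [tendsto_nhdsWithin_iff]
      refine ⟨by simpa using hδ0.const_add a, ?_⟩
      filter_upwards [self_mem_nhdsWithin] with x hx
      have := hδpos x hx
      simp only [mem_Ioi]; linarith
    have L1 := (hfd.comp (hshift s)).mul hδs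
    have L2 := (hgd.comp (hshift (T s))).mul hδs
    have L := (L1.rpow_const (p := 1 - l) (Or.inr hl1'.le)).mul
      (L2.rpow_const (p := l) (Or.inr hl0.le))
    have key : (f * κ) ^ (1 - l) * (g * κ) ^ l ≤ f := by
      refine le_of_tendsto_of_tendsto L hfd ?_
      have e2 : ∀ᶠ x in nhdsWithin s (Ioi s), x ∈ U := nhdsWithin_le_nhds (hUo.mem_nhds hs)
      filter_upwards [self_mem_nhdsWithin, e2] with x hx hxU
      have hx : s < x := hx
      have hx' : 0 < x - s := by linarith
      have hdp := hδpos x hx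
      have b1 := hb s (T s) (δ x) hdp
      have b2 := ha s (T s) hs.1 hs.2 (hT s).symm
      have b3 := ha x (T x) hxU.1 hxU.2 (hT x).symm
      have b4 : (1 - l) * s + l * T s + δ x = (1 - l) * x + l * T x := by simp only [hδ]; ring
      rw [b4, b2, b3] at b1
      simp only [Function.comp, slope_def_field]
      have n1 : 0 ≤ F (s + δ x) - F s := by linarith [hF.mono (show s ≤ s + δ x by linarith)]
      have n2 : 0 ≤ G (T s + δ x) - G (T s) := by
        linarith [hG.mono (show T s ≤ T s + δ x by linarith)]
      have c1 : (F (s + δ x) - F s) / (s + δ x - s) * (δ x / (x - s)) =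
          (F (s + δ x) - F s) / (x - s) := by
        rw [add_sub_cancel_left]; field_simp
      have c2 : (G (T s + δ x) - G (T s)) / (T s + δ x - T s) * (δ x / (x - s)) =
          (G (T s + δ x) - G (T s)) / (x - s) := by
        rw [add_sub_cancel_left]; field_simp
      rw [c1, c2, Real.div_rpow n1 hx'.le, Real.div_rpow n2 hx'.le, div_mul_div_comm,
        ← Real.rpow_add hx']
      simp only [sub_add_cancel, Real.rpow_one]
      gcongr
    have hρ : f / g = 1 := by
      by_contra hne
      have hρ0 : 0 < f / g := by positivity
      have bern := _root_.rpow_one_add_lt_one_add_mul_self (s := f / g - 1) (by linarith)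
        (fun h => hne (by linarith)) hl0 hl1
      have e1 : 1 + (f / g - 1) = f / g := by ring
      have e2 : 1 + l * (f / g - 1) = κ := by simp only [hκ]; ring
      rw [e1, e2] at bern
      have e3 : (f * κ) ^ (1 - l) * (g * κ) ^ l = f ^ (1 - l) * g ^ l * κ := by
        rw [Real.mul_rpow hf.le hκ0.le, Real.mul_rpow hg.le hκ0.le]
        have : κ ^ (1 - l) * κ ^ l = κ := by
          rw [← Real.rpow_add hκ0]; simp
        calc _ = f ^ (1 - l) * g ^ l * (κ ^ (1 - l) * κ ^ l) := by ring
          _ = _ := by rw [this]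
      have e4 : f ^ (1 - l) * g ^ l * (f / g) ^ l = f := by
        rw [Real.div_rpow hf.le hg.le]
        have : f ^ (1 - l) * f ^ l = f := by
          rw [← Real.rpow_add hf]; simp
        have hgl : g ^ l ≠ 0 := by positivity
        field_simp
        exact this
      rw [e3] at key
      have hpos : 0 < f ^ (1 - l) * g ^ l := by positivity
      have := mul_lt_mul_of_pos_left bern hpos
      linarith
    rw [hρ] at hTs
    rw [hasDerivWithinAt_iff_tendsto_slope' (by simp)]
    exact hTs
  -- T - id is constant on U
  have hconst : ∀ s ∈ U, ∀ t ∈ U, s ≤ t → T t - t = T s - s := by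
    intro s hs t ht hst
    have hIcc : ∀ x ∈ Icc s t, x ∈ U := fun x hx =>
      ⟨lt_of_lt_of_le hs.1 (hF.mono hx.1), lt_of_le_of_lt (hF.mono hx.2) ht.2⟩
    refine constant_of_has_deriv_right_zero (f := fun x => T x - x) (a := s) (b := t)
      (fun x hx => ((hTcont x (hIcc x hx)).sub continuousAt_id).continuousWithinAt) ?_ t
      ⟨hst, le_rfl⟩
    intro x hx
    have := (hTder x (hIcc x ⟨hx.1, hx.2.le⟩)).sub (hasDerivWithinAt_id x (Ioi x))
    rw [sub_self] at this
    exact hasDerivWithinAt_Ioi_iff_Ici.1 this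
  obtain ⟨s₀, hs₀⟩ := hF.ex (1 / 2) (by norm_num) (by norm_num)
  have hs₀U : s₀ ∈ U := by constructor <;> rw [hs₀] <;> norm_num
  set c := T s₀ - s₀
  have hTc : ∀ s ∈ U, F s = G (s + c) := by
    intro s hs
    have : T s - s = c := by
      rcases le_total s s₀ with h | h
      · exact (hconst s hs s₀ hs₀U h).symm
      · exact hconst s₀ hs₀U s hs h
    rw [← hT s]; congr 1; linarith
  refine ⟨c, fun s => ?_⟩
  rcases (hF.nonneg s).eq_or_lt with h0 | h0
  · by_contra hne
    have hp : 0 < G (s + c) := lt_of_le_of_ne (hG.nonneg _) (by rwa [h0])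
    have hle := hG.le_one (s + c)
    obtain ⟨x, hx⟩ := hF.ex (G (s + c) / 2) (by linarith) (by linarith)
    have hxU : x ∈ U := by constructor <;> rw [hx] <;> linarith
    have h1 := hTc x hxU
    have : s < x := hF.lt_of_lt (by rw [← h0, hx]; linarith)
    have := hG.mono (show s + c ≤ x + c by linarith)
    linarith
  rcases (hF.le_one s).eq_or_lt with h1 | h1
  · by_contra hne
    have hp : G (s + c) < 1 := lt_of_le_of_ne (hG.le_one _) (by rw [← h1]; exact fun h => hne h.symm)
    have hle := hG.nonneg (s + c)
    obtain ⟨x, hx⟩ := hF.ex ((1 + G (s + c)) / 2) (by linarith) (by linarith)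
    have hxU : x ∈ U := by constructor <;> rw [hx] <;> linarith
    have h1 := hTc x hxU
    have : x < s := hF.lt_of_lt (by rw [hx]; linarith)
    have := hG.mono (show x + c ≤ s + c by linarith)
    linarith
  exact hTc s ⟨h0, h1⟩

end LCdf

/-- Distribution function of a set in direction `u`. -/
def dirCdf {n : ℕ} (K : Set (EuclideanSpace ℝ (Fin n))) (u : EuclideanSpace ℝ (Fin n)) (s : ℝ) : ℝ :=
  volume.real (K ∩ {x | inner ℝ u x ≤ s})

theorem bm_mul_real {n : ℕ} {l : ℝ} (h0 : 0 < l) (h1 : l < 1)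
    {A B M : Set (EuclideanSpace ℝ (Fin n))}
    (hA : MeasurableSet A) (hB : MeasurableSet B) (hM : MeasurableSet M) (hMf : volume M ≠ ∞)
    (H : ∀ x ∈ A, ∀ y ∈ B, (1 - l) • x + l • y ∈ M) :
    volume.real A ^ (1 - l) * volume.real B ^ l ≤ volume.real M := by
  have := ENNReal.toReal_mono hMf (bm_mul h0 h1 hA hB hM H)
  rwa [ENNReal.toReal_mul, ← ENNReal.toReal_rpow, ← ENNReal.toReal_rpow] at this

theorem meas_le {n : ℕ} (u : EuclideanSpace ℝ (Fin n)) (s : ℝ) :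
    MeasurableSet {x : EuclideanSpace ℝ (Fin n) | inner ℝ u x ≤ s} :=
  (isClosed_le (by fun_prop) continuous_const).measurableSet

theorem meas_lt {n : ℕ} (u : EuclideanSpace ℝ (Fin n)) (s : ℝ) :
    MeasurableSet {x : EuclideanSpace ℝ (Fin n) | s < inner ℝ u x} :=
  (isOpen_lt continuous_const (by fun_prop)).measurableSet

theorem hyperplane_null {n : ℕ} (u : EuclideanSpace ℝ (Fin n)) (hu : ‖u‖ = 1) (s : ℝ) :
    volume {x : EuclideanSpace ℝ (Fin n) | inner ℝ u x = s} = 0 := by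
  have hker : volume ((LinearMap.ker (innerSL ℝ u).toLinearMap : Submodule ℝ _) : Set (EuclideanSpace ℝ (Fin n))) = 0 := by
    apply Measure.addHaar_submodule
    intro h
    have : u ∈ LinearMap.ker (innerSL ℝ u).toLinearMap := by rw [h]; trivial
    simp at this
    rw [this] at hu
    simp at hu
  have := measure_preimage_add volume (-(s • u)) ((LinearMap.ker (innerSL ℝ u).toLinearMap : Submodule ℝ _) : Set (EuclideanSpace ℝ (Fin n)))
  rw [hker] at this
  rw [← this]
  congr 1
  ext x
  simp [inner_add_right, inner_smul_right, real_inner_self_eq_norm_sq, hu]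
  constructor <;> intro h <;> linarith

theorem dirCdf_cont {n : ℕ} {K : Set (EuclideanSpace ℝ (Fin n))} (hK : MeasurableSet K)
    (hKf : volume K ≠ ∞) (u : EuclideanSpace ℝ (Fin n)) (hu : ‖u‖ = 1) : Continuous (dirCdf K u) := by
  have e : dirCdf K u = fun s => ∫ x in K, {y | inner ℝ u y ≤ s}.indicator (fun _ => (1 : ℝ)) x := by
    ext s
    rw [integral_indicator (meas_le u s), setIntegral_const, measureReal_restrict_apply (meas_le u s)]
    simp [dirCdf, inter_comm]
  rw [e, continuous_iff_continuousAt]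
  intro s
  refine continuousAt_of_dominated (bound := fun _ => 1) ?_ ?_ ?_ ?_
  · exact Eventually.of_forall fun t =>
      (measurable_const.indicator (meas_le u t)).aestronglyMeasurable
  · refine Eventually.of_forall fun t => ae_of_all _ fun x => ?_
    by_cases hx : inner ℝ u x ≤ t <;> simp [indicator, hx]
  · exact integrableOn_const hKf
  · have hn : ∀ᵐ x ∂(volume : Measure (EuclideanSpace ℝ (Fin n))), inner ℝ u x ≠ s := by
      rw [ae_iff]; simpa using hyperplane_null u hu s
    filter_upwards [ae_restrict_of_ae hn] with x hx
    rcases lt_or_gt_of_ne hx with h | h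
    · refine ContinuousAt.congr (f := fun _ => (1 : ℝ)) continuousAt_const ?_
      filter_upwards [lt_mem_nhds h] with t ht
      simp [indicator, ht.le]
    · refine ContinuousAt.congr (f := fun _ => (0 : ℝ)) continuousAt_const ?_
      filter_upwards [gt_mem_nhds h] with t ht
      simp [indicator, ht]

theorem inner_comb {n : ℕ} (u x y : EuclideanSpace ℝ (Fin n)) (l : ℝ) :
    inner ℝ u ((1 - l) • x + l • y) = (1 - l) * inner ℝ u x + l * inner ℝ u y := by
  simp [inner_add_right, inner_smul_right]

theorem dirCdf_lc {n : ℕ} {K : Set (EuclideanSpace ℝ (Fin n))} (hK : MeasurableSet K)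
    (hKb : IsBounded K) (hKc : Convex ℝ K) (hK1 : volume K = 1)
    (u : EuclideanSpace ℝ (Fin n)) (hu : ‖u‖ = 1) : LCdf (dirCdf K u) := by
  have hfin : ∀ A, volume (K ∩ A) ≠ ∞ := fun A =>
    ((measure_mono inter_subset_left).trans_lt (by rw [hK1]; simp)).ne
  obtain ⟨D, hD⟩ := hKb.subset_closedBall 0
  have hD' : ∀ x ∈ K, |inner ℝ u x| ≤ D := by
    intro x hx
    have h1 := abs_real_inner_le_norm u x
    have h2 := hD hx
    rw [mem_closedBall_zero_iff] at h2
    rw [hu, one_mul] at h1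
    linarith
  refine ⟨?_, dirCdf_cont hK (by simp [hK1]) u hu, fun s => measureReal_nonneg, ?_, ?_, ?_, ?_⟩
  · intro s t hst
    exact measureReal_mono (inter_subset_inter_right _ fun x hx => le_trans (show _ ≤ s from hx) hst) (hfin _)
  · intro s
    have : volume.real K = 1 := by simp [Measure.real, hK1]
    rw [← this]
    exact measureReal_mono inter_subset_left (by simp [hK1])
  · refine ⟨-D - 1, ?_⟩
    have : K ∩ {x | inner ℝ u x ≤ -D - 1} = ∅ := by
      ext x
      simp only [mem_inter_iff, mem_ofPred_eq, mem_empty_iff_false, iff_false, not_and, not_le]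
      intro hx
      have := (abs_le.1 (hD' x hx)).1
      linarith
    simp [dirCdf, this]
  · refine ⟨D, ?_⟩
    have : K ∩ {x | inner ℝ u x ≤ D} = K :=
      inter_eq_left.2 fun x hx => (abs_le.1 (hD' x hx)).2
    simp [dirCdf, this, Measure.real, hK1]
  · intro l h0 h1 s t
    have h1' : 0 < 1 - l := by linarith
    refine bm_mul_real h0 h1 (hK.inter (meas_le u s)) (hK.inter (meas_le u t))
      (hK.inter (meas_le u _)) (hfin _) ?_
    rintro x ⟨hx, hxs⟩ y ⟨hy, hyt⟩
    refine ⟨hKc hx hy h1'.le h0.le (by ring), ?_⟩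
    simp only [mem_ofPred_eq] at *
    rw [inner_comb]
    gcongr

theorem dirCdf_translate {n : ℕ} {K L M : Set (EuclideanSpace ℝ (Fin n))} (hK : MeasurableSet K)
    (hKb : IsBounded K) (hKc : Convex ℝ K) (hK1 : volume K = 1)
    (hL : MeasurableSet L)
    (hLb : IsBounded L) (hLc : Convex ℝ L) (hL1 : volume L = 1)
    (hM : MeasurableSet M) (hM1 : volume M ≤ 1) {l : ℝ} (h0 : 0 < l) (h1 : l < 1)
    (H : ∀ x ∈ K, ∀ y ∈ L, (1 - l) • x + l • y ∈ M)
    (u : EuclideanSpace ℝ (Fin n)) (hu : ‖u‖ = 1) :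
    ∃ c, ∀ s, dirCdf K u s = dirCdf L u (s + c) := by
  have h1' : 0 < 1 - l := by linarith
  have hMf : volume M ≠ ∞ := (hM1.trans_lt (by simp)).ne
  have hMf' : ∀ A, volume (M ∩ A) ≠ ∞ := fun A =>
    ((measure_mono inter_subset_left).trans_lt hMf.lt_top).ne
  have hM1' : volume.real M ≤ 1 := by
    have := ENNReal.toReal_mono ENNReal.one_ne_top hM1
    simpa [Measure.real] using this
  have compl : ∀ A : Set (EuclideanSpace ℝ (Fin n)), volume A ≠ ∞ → ∀ s,
      volume.real (A ∩ {x | inner ℝ u x ≤ s}) + volume.real (A ∩ {x | s < inner ℝ u x})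
        = volume.real A := by
    intro A hA s
    have := measureReal_inter_add_sdiff (μ := volume) (s := A) (meas_le u s) hA
    convert this using 3
    ext x; simp
  have slab : ∀ A : Set (EuclideanSpace ℝ (Fin n)), volume A ≠ ∞ → ∀ s t, s ≤ t →
      volume.real (A ∩ {x | inner ℝ u x ≤ t} ∩ {x | s < inner ℝ u x})
        = dirCdf A u t - dirCdf A u s := by
    intro A hA s t hst
    have := measureReal_inter_add_sdiff (μ := volume) (s := A ∩ {x | inner ℝ u x ≤ t}) (meas_le u s)
      ((measure_mono inter_subset_left).trans_lt hA.lt_top).ne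
    have e1 : A ∩ {x | inner ℝ u x ≤ t} ∩ {x | inner ℝ u x ≤ s} = A ∩ {x | inner ℝ u x ≤ s} := by
      ext x
      simp only [mem_inter_iff, mem_ofPred_eq]
      constructor
      · rintro ⟨⟨h1, h2⟩, h3⟩; exact ⟨h1, h3⟩
      · rintro ⟨h1, h3⟩; exact ⟨⟨h1, h3.trans hst⟩, h3⟩
    have e2 : (A ∩ {x | inner ℝ u x ≤ t}) \ {x | inner ℝ u x ≤ s} =
      A ∩ {x | inner ℝ u x ≤ t} ∩ {x | s < inner ℝ u x} := by
      ext x; simp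
    rw [e1, e2] at this
    unfold dirCdf
    linarith
  have pp : ∀ p : ℝ, 0 < p → p ^ (1 - l) * p ^ l = p := by
    intro p hp
    rw [← Real.rpow_add hp]; simp
  refine LCdf.eq_translate (H := dirCdf M u) (dirCdf_lc hK hKb hKc hK1 u hu)
    (dirCdf_lc hL hLb hLc hL1 u hu) l h0 h1 ?_ ?_
  · intro s t hs0 hs1 hst
    have k1 : dirCdf K u s ^ (1 - l) * dirCdf L u t ^ l ≤ dirCdf M u ((1 - l) * s + l * t) := by
      refine bm_mul_real h0 h1 (hK.inter (meas_le u s)) (hL.inter (meas_le u t))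
        (hM.inter (meas_le u _)) (hMf' _) ?_
      rintro x ⟨hx, hxs⟩ y ⟨hy, hyt⟩
      refine ⟨H x hx y hy, ?_⟩
      simp only [mem_ofPred_eq] at *
      rw [inner_comb]
      gcongr
    have k2 : volume.real (K ∩ {x | s < inner ℝ u x}) ^ (1 - l) *
        volume.real (L ∩ {x | t < inner ℝ u x}) ^ l ≤
        volume.real (M ∩ {x | (1 - l) * s + l * t < inner ℝ u x}) := by
      refine bm_mul_real h0 h1 (hK.inter (meas_lt u s)) (hL.inter (meas_lt u t))
        (hM.inter (meas_lt u _)) (hMf' _) ?_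
      rintro x ⟨hx, hxs⟩ y ⟨hy, hyt⟩
      refine ⟨H x hx y hy, ?_⟩
      simp only [mem_ofPred_eq] at *
      rw [inner_comb]
      gcongr
    have c1 := compl K (by simp [hK1]) s
    have c2 := compl L (by simp [hL1]) t
    have c3 := compl M hMf ((1 - l) * s + l * t)
    have eK : volume.real K = 1 := by simp [Measure.real, hK1]
    have eL : volume.real L = 1 := by simp [Measure.real, hL1]
    rw [eK] at c1
    rw [eL] at c2
    change dirCdf K u s + _ = 1 at c1
    change dirCdf L u t + _ = 1 at c2
    change dirCdf M u _ + _ = _ at c3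
    have d1 : volume.real (K ∩ {x | s < inner ℝ u x}) = 1 - dirCdf K u s := by linarith
    have d2 : volume.real (L ∩ {x | t < inner ℝ u x}) = 1 - dirCdf K u s := by linarith
    rw [d1, d2, pp _ (by linarith)] at k2
    rw [← hst, pp _ hs0] at k1
    linarith
  · intro s t δ hδ
    rw [← slab K (by simp [hK1]) s (s + δ) (by linarith),
      ← slab L (by simp [hL1]) t (t + δ) (by linarith), ← slab M hMf _ _ (by linarith)]
    refine bm_mul_real h0 h1 ((hK.inter (meas_le u _)).inter (meas_lt u _))
      ((hL.inter (meas_le u _)).inter (meas_lt u _))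
        ((hM.inter (meas_le u _)).inter (meas_lt u _)) ?_ ?_
    · rw [inter_assoc]; exact hMf' _
    rintro x ⟨⟨hx, hxs⟩, hxs'⟩ y ⟨⟨hy, hyt⟩, hyt'⟩
    simp only [mem_ofPred_eq] at *
    refine ⟨⟨H x hx y hy, ?_⟩, ?_⟩
    · simp only [mem_ofPred_eq]
      rw [inner_comb]
      nlinarith
    · simp only [mem_ofPred_eq]
      rw [inner_comb]
      gcongr

/-- The equality case of Brunn–Minkowski against a ball. -/
theorem bm_equality {n : ℕ} {K M : Set (EuclideanSpace ℝ (Fin n))} (hK : IsCompact K)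
    (hKc : Convex ℝ K) (hK1 : volume K = 1) {R : ℝ} (hR : 0 < R)
    (hL1 : volume (ball (0 : EuclideanSpace ℝ (Fin n)) R) = 1)
    (hM : MeasurableSet M) (hM1 : volume M ≤ 1) {l : ℝ} (h0 : 0 < l) (h1 : l < 1)
    (H : ∀ x ∈ K, ∀ y ∈ ball (0 : EuclideanSpace ℝ (Fin n)) R, (1 - l) • x + l • y ∈ M) :
    ∃ z, K = closedBall z R := by
  have hint : IntegrableOn (fun x : EuclideanSpace ℝ (Fin n) => x) K :=
    continuous_id.continuousOn.integrableOn_compact hK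
  set L := ball (0 : EuclideanSpace ℝ (Fin n)) R with hL
  set z := ∫ x in K, x with hz
  have hLint : IntegrableOn (fun x : EuclideanSpace ℝ (Fin n) => x) L :=
    (continuous_id.continuousOn.integrableOn_compact (isCompact_closedBall 0 R)).mono_set
      ball_subset_closedBall
  have hbal : ∫ x in L, x = 0 := by
    have e0 : ∫ x in L, x = ∫ x, L.indicator (fun x => x) x :=
      (integral_indicator measurableSet_ball).symm
    have e : ∫ x, L.indicator (fun x => x) x = - ∫ x, L.indicator (fun x => x) x := by
      rw [← integral_neg, ← integral_neg_eq_self]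
      congr 1
      ext1 x
      have hiff : -x ∈ L ↔ x ∈ L := by simp [hL]
      by_cases hx : x ∈ L
      · rw [indicator_of_mem hx, indicator_of_mem (hiff.2 hx)]
      · rw [indicator_of_notMem hx, indicator_of_notMem (fun h => hx (hiff.1 h)), neg_zero]
    rw [e0]
    have h2 : (2 : ℝ) • (∫ x, L.indicator (fun x => x) x) = 0 := by
      rw [two_smul]; nth_rewrite 2 [e]; exact add_neg_cancel _
    exact (smul_eq_zero.1 h2).resolve_left two_ne_zero
  haveI : IsFiniteMeasure (volume.restrict K) := ⟨by simp [hK1]⟩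
  haveI : IsFiniteMeasure (volume.restrict L) := ⟨by simp [hL1]⟩
  have key : ∀ u : EuclideanSpace ℝ (Fin n), ‖u‖ = 1 →
      volume (K ∩ {x | R + inner ℝ u z < inner ℝ u x}) = 0 := by
    intro u hu
    obtain ⟨c, hc⟩ := dirCdf_translate hK.measurableSet hK.isBounded hKc hK1 measurableSet_ball
      isBounded_ball (convex_ball 0 R) hL1 hM hM1 h0 h1 H u hu
    have hmu : Measurable fun x : EuclideanSpace ℝ (Fin n) => inner ℝ u x := by fun_prop
    have hmeq : (volume.restrict K).map (fun x => inner ℝ u x) =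
        (volume.restrict L).map (fun x => inner ℝ u x - c) := by
      haveI := Measure.isFiniteMeasure_map (volume.restrict K) (fun x => inner ℝ u x)
      refine Measure.ext_of_Iic _ _ fun s => ?_
      rw [Measure.map_apply hmu measurableSet_Iic, Measure.map_apply (hmu.sub_const c) measurableSet_Iic,
        Measure.restrict_apply (hmu measurableSet_Iic),
        Measure.restrict_apply ((hmu.sub_const c) measurableSet_Iic)]
      have := hc s
      unfold dirCdf at this
      rw [measureReal_eq_measureReal_iff (h₁ := ?_) (h₂ := ?_)] at this
      · convert this using 2
        · rw [inter_comm]; rfl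
        · rw [inter_comm]; congr 1; ext x; simp [sub_le_iff_le_add]
      · exact ((measure_mono inter_subset_left).trans_lt (by rw [hK1]; simp)).ne
      · exact ((measure_mono inter_subset_left).trans_lt (by rw [hL1]; simp)).ne
    have hmean : inner ℝ u z = -c := by
      have e1 : ∫ y, y ∂((volume.restrict K).map (fun x => inner ℝ u x)) = inner ℝ u z := by
        rw [integral_map hmu.aemeasurable (by fun_prop), integral_inner hint]
      have e2 : ∫ y, y ∂((volume.restrict L).map (fun x => inner ℝ u x - c)) = -c := by
        rw [integral_map (hmu.sub_const c).aemeasurable (by fun_prop), integral_sub,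
          integral_inner hLint, hbal]
        · simp [Measure.real, hL1]
        · exact hLint.const_inner u
        · exact integrable_const c
      rw [← e1, hmeq, e2]
    have h2 := hc (R + inner ℝ u z)
    have e3 : R + inner ℝ u z + c = R := by rw [hmean]; ring
    have e4 : dirCdf L u R = 1 := by
      unfold dirCdf
      rw [inter_eq_left.2]
      · simp [Measure.real, hL1]
      · intro x hx
        have h1 := real_inner_le_norm u x
        rw [hu, one_mul] at h1
        rw [hL, mem_ball_zero_iff] at hx
        exact h1.trans hx.le
    rw [e3, e4] at h2
    have := measureReal_inter_add_sdiff (μ := volume) (s := K) (meas_le u (R + inner ℝ u z)) (by simp [hK1])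
    unfold dirCdf at h2
    have eK : volume.real K = 1 := by simp [Measure.real, hK1]
    rw [h2, eK] at this
    have h5 : volume.real (K \ {x | inner ℝ u x ≤ R + inner ℝ u z}) = 0 := by linarith
    rw [measureReal_eq_zero_iff ((measure_mono sdiff_subset).trans_lt (by rw [hK1]; simp)).ne] at h5
    convert h5 using 2
    ext x; simp
  have hne : (interior K).Nonempty := by
    by_contra hcon
    rw [not_nonempty_iff_eq_empty] at hcon
    have h3 := hKc.addHaar_frontier volume
    rw [frontier, hcon, hK.isClosed.closure_eq, sdiff_empty, hK1] at h3
    simp at h3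
  have hsub1 : interior K ⊆ closedBall z R := by
    intro x hx
    by_contra hxz
    rw [mem_closedBall, not_le, dist_eq_norm] at hxz
    have hpos : 0 < ‖x - z‖ := hR.trans hxz
    set u := (‖x - z‖⁻¹) • (x - z) with hu
    have hu1 : ‖u‖ = 1 := by
      rw [hu, norm_smul, norm_inv, norm_norm, inv_mul_cancel₀ hpos.ne']
    have hop : IsOpen (interior K ∩ {x | R + inner ℝ u z < inner ℝ u x}) :=
      isOpen_interior.inter (isOpen_lt continuous_const (by fun_prop))
    have hnull : volume (interior K ∩ {x | R + inner ℝ u z < inner ℝ u x}) = 0 :=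
      measure_mono_null (inter_subset_inter_left _ interior_subset) (key u hu1)
    have hemp := hop.measure_eq_zero_iff volume |>.1 hnull
    have : x ∈ interior K ∩ {x | R + inner ℝ u z < inner ℝ u x} := by
      refine ⟨hx, ?_⟩
      have : inner ℝ u x - inner ℝ u z = ‖x - z‖ := by
        rw [← inner_sub_right, hu, inner_smul_left, real_inner_self_eq_norm_sq]
        simp; field_simp
      simp only [mem_ofPred_eq]; linarith
    rw [hemp] at this
    exact this
  have hsub : K ⊆ closedBall z R := by
    have := hKc.closure_interior_eq_closure_of_nonempty_interior hne
    rw [hK.isClosed.closure_eq] at this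
    rw [← this]
    exact closure_minimal hsub1 isClosed_closedBall
  refine ⟨z, hsub.antisymm ?_⟩
  have hball : ball z R ⊆ K := by
    have hop : IsOpen (ball z R \ K) := isOpen_ball.sdiff hK.isClosed
    have hv : volume (closedBall z R) = 1 := by
      rw [Measure.addHaar_closedBall _ _ hR.le, ← Measure.addHaar_ball_of_pos _ _ hR]
      rw [← hL1, hL, Measure.addHaar_ball_center]
    have hnull : volume (ball z R \ K) = 0 := by
      have : volume (closedBall z R \ K) = 0 := by
        rw [measure_sdiff hsub hK.measurableSet.nullMeasurableSet (by simp [hK1]), hv, hK1]; simp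
      exact measure_mono_null (sdiff_subset_sdiff_left ball_subset_closedBall) this
    have hemp := hop.measure_eq_zero_iff volume |>.1 hnull
    exact sdiff_eq_empty.1 hemp
  rw [← closure_ball z hR.ne']
  exact closure_minimal hball hK.isClosed

theorem vol_ball_pos {n : ℕ} (x : EuclideanSpace ℝ (Fin n)) {a : ℝ} (ha : 0 < a) :
    volume (ball x a) = ENNReal.ofReal (a ^ n) * volume (ball (0 : EuclideanSpace ℝ (Fin n)) 1) := by
  have := Measure.addHaar_ball_of_pos volume x ha
  simpa using this

theorem vol_ball_nonneg {n : ℕ} (hn : 2 ≤ n) (x : EuclideanSpace ℝ (Fin n)) {a : ℝ} (ha : 0 ≤ a) :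
    volume (ball x a) = ENNReal.ofReal (a ^ n) * volume (ball (0 : EuclideanSpace ℝ (Fin n)) 1) := by
  rcases ha.eq_or_lt with rfl | h
  · simp [show n ≠ 0 by omega]
  · exact vol_ball_pos x h

theorem unit_ball_ne_zero {n : ℕ} : volume (ball (0 : EuclideanSpace ℝ (Fin n)) 1) ≠ 0 :=
  (measure_ball_pos volume _ one_pos).ne'

theorem unit_ball_ne_top {n : ℕ} : volume (ball (0 : EuclideanSpace ℝ (Fin n)) 1) ≠ ∞ :=
  measure_ball_lt_top.ne

theorem le_of_vol_ball_le {n : ℕ} (hn : 2 ≤ n) {a b : ℝ} (ha : 0 < a) (hb : 0 < b)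
    (h : volume (ball (0 : EuclideanSpace ℝ (Fin n)) a) ≤
      volume (ball (0 : EuclideanSpace ℝ (Fin n)) b)) : a ≤ b := by
  rw [vol_ball_pos _ ha, vol_ball_pos _ hb,
    ENNReal.mul_le_mul_iff_left unit_ball_ne_zero unit_ball_ne_top,
    ENNReal.ofReal_le_ofReal_iff (by positivity)] at h
  exact le_of_pow_le_pow_left₀ (by omega) hb.le h

theorem unitRadius_pos (n : ℕ) : 0 < unitRadius n :=
  Real.rpow_pos_of_pos (ENNReal.toReal_pos unit_ball_ne_zero unit_ball_ne_top) _

theorem vol_ball_unitRadius {n : ℕ} (hn : 2 ≤ n) (x : EuclideanSpace ℝ (Fin n)) :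
    volume (ball x (unitRadius n)) = 1 := by
  have hp := ENNReal.toReal_pos (unit_ball_ne_zero (n := n)) unit_ball_ne_top
  rw [vol_ball_pos _ (unitRadius_pos n)]
  rw [← ENNReal.ofReal_toReal (unit_ball_ne_top (n := n)), ← ENNReal.ofReal_mul
    (pow_nonneg (unitRadius_pos n).le _), ← ENNReal.ofReal_one]
  congr 1
  unfold unitRadius
  rw [← Real.rpow_natCast, ← Real.rpow_mul hp.le, neg_mul, inv_mul_cancel₀
    (by positivity), Real.rpow_neg_one, inv_mul_cancel₀ hp.ne']

theorem bm_add {n : ℕ} {A M : Set (EuclideanSpace ℝ (Fin n))} (hA : MeasurableSet A)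
    (hM : MeasurableSet M) {a s : ℝ} (ha : 0 < a) (hs : 0 < s)
    (hv : volume (ball (0 : EuclideanSpace ℝ (Fin n)) a) ≤ volume A)
    (H : ∀ x ∈ A, ∀ y ∈ ball (0 : EuclideanSpace ℝ (Fin n)) s, x + y ∈ M) :
    volume (ball (0 : EuclideanSpace ℝ (Fin n)) (a + s)) ≤ volume M := by
  have has : 0 < a + s := by positivity
  have h0 : 0 < s / (a + s) := by positivity
  have h1 : s / (a + s) < 1 := by rw [div_lt_one has]; linarith
  set ω := volume (ball (0 : EuclideanSpace ℝ (Fin n)) 1) with hω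
  have scale : ∀ (S : Set (EuclideanSpace ℝ (Fin n))) (c : ℝ), 0 < c →
      (ENNReal.ofReal (c ^ n) * ω ≤ volume S ↔ ω ≤ volume (c⁻¹ • S)) := by
    intro S c hc
    have hcn : 0 < c ^ n := by positivity
    rw [Measure.addHaar_smul, finrank_euclideanSpace_fin, inv_pow, abs_of_pos (by positivity),
      ENNReal.ofReal_inv_of_pos hcn, mul_comm, ← ENNReal.div_eq_inv_mul,
      ENNReal.le_div_iff_mul_le (Or.inl (ENNReal.ofReal_pos.2 hcn).ne') (Or.inl ENNReal.ofReal_ne_top)]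
  have key := bm_mul (A := a⁻¹ • A) (B := ball 0 1) (M := (a + s)⁻¹ • M) h0 h1
    (hA.const_smul_of_ne_zero (by positivity)) measurableSet_ball
    (hM.const_smul_of_ne_zero (by positivity)) ?_
  · rw [vol_ball_pos _ has]
    rw [vol_ball_pos _ ha] at hv
    have hv' := (scale A a ha).1 hv
    refine (scale M _ has).2 (le_trans ?_ key)
    calc ω = ω ^ (1 - s / (a + s)) * ω ^ (s / (a + s)) := by
          rw [← ENNReal.rpow_add _ _ unit_ball_ne_zero unit_ball_ne_top]; simp [hω]
      _ ≤ _ := by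
          gcongr
  · rintro _ ⟨x, hx, rfl⟩ y hy
    refine ⟨x + s • y, H x hx _ ?_, ?_⟩
    · rw [mem_ball_zero_iff] at hy ⊢
      rw [norm_smul, Real.norm_of_nonneg hs.le]
      nlinarith
    · simp only [smul_add, smul_smul]
      congr 2 <;> field_simp
      ring

theorem interior_subset_density {n : ℕ} (E : Set (EuclideanSpace ℝ (Fin n))) :
    interior E ⊆ densityOnePoints n E := by
  intro x hx
  obtain ⟨δ, hδ, hsub⟩ := Metric.mem_nhds_iff.1 (mem_interior_iff_mem_nhds.1 hx)
  refine Tendsto.congr' (f₁ := fun _ => 1) ?_ tendsto_const_nhds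
  filter_upwards [Ioo_mem_nhdsGT hδ] with ρ hρ
  rw [inter_eq_right.2 ((ball_subset_ball hρ.2.le).trans hsub),
    ENNReal.div_self (measure_ball_pos _ _ hρ.1).ne' measure_ball_lt_top.ne]

theorem density_subset_closure {n : ℕ} (E : Set (EuclideanSpace ℝ (Fin n))) :
    densityOnePoints n E ⊆ closure E := by
  intro x hx
  by_contra hc
  obtain ⟨δ, hδ, hsub⟩ := Metric.mem_nhds_iff.1 (isClosed_closure.isOpen_compl.mem_nhds hc)
  have : Tendsto (fun ρ : ℝ => volume (E ∩ ball x ρ) / volume (ball x ρ))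
        (nhdsWithin 0 (Ioi 0)) (nhds 0) := by
    refine Tendsto.congr' (f₁ := fun _ => 0) ?_ tendsto_const_nhds
    filter_upwards [Ioo_mem_nhdsGT hδ] with ρ hρ
    have : E ∩ ball x ρ = ∅ := by
      ext y
      simp only [mem_inter_iff, mem_empty_iff_false, iff_false, not_and]
      intro hy hy'
      exact hsub (ball_subset_ball hρ.2.le hy') (subset_closure hy)
    simp [this]
  exact zero_ne_one (tendsto_nhds_unique this hx)

theorem interior_nonempty_of_vol {n : ℕ} {E : Set (EuclideanSpace ℝ (Fin n))} (hc : Convex ℝ E)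
    (h1 : volume E = 1) : (interior E).Nonempty := by
  by_contra hcon
  rw [not_nonempty_iff_eq_empty] at hcon
  have h3 := hc.addHaar_frontier volume
  rw [frontier, hcon, sdiff_empty] at h3
  have := measure_mono_null subset_closure h3
  simp [h1] at this

theorem frontier_density {n : ℕ} {E : Set (EuclideanSpace ℝ (Fin n))} (hc : Convex ℝ E)
    (h1 : volume E = 1) : frontier (densityOnePoints n E) = frontier E := by
  have hne := interior_nonempty_of_vol hc h1
  have a1 := interior_subset_density E
  have a2 := density_subset_closure E
  have c1 : closure (densityOnePoints n E) = closure E := by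
    apply (closure_minimal a2 isClosed_closure).antisymm
    rw [← hc.closure_interior_eq_closure_of_nonempty_interior hne]
    exact closure_mono a1
  have c2 : interior (densityOnePoints n E) = interior E := by
    apply Subset.antisymm
    · rw [← hc.interior_closure_eq_interior_of_nonempty_interior hne]
      exact interior_mono a2
    · exact interior_maximal a1 isOpen_interior
  rw [frontier, frontier, c1, c2]

theorem minkSum_eq {n : ℕ} (r : ℝ) (A : Set (EuclideanSpace ℝ (Fin n))) :
    minkSum n r A = thickening r A := thickening_eq_biUnion_ball.symm

theorem per_lower {n : ℕ} (hn : 2 ≤ n) {r : ℝ} (hr : 0 < r)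
    {E : Set (EuclideanSpace ℝ (Fin n))} (hc : Convex ℝ E) (h1 : volume E = 1) :
    volume (thickening r E) ≤ volume (minkSum n r (frontier (densityOnePoints n E))) +
      volume (ball (0 : EuclideanSpace ℝ (Fin n)) (unitRadius n - r)) := by
  rw [frontier_density hc h1, minkSum_eq]
  set A := closure E \ thickening r (frontier E) with hA
  have hAm : MeasurableSet A := isClosed_closure.measurableSet.diff isOpen_thickening.measurableSet
  have hball : ∀ x ∈ A, ball x r ⊆ interior E := by
    rintro x ⟨hx, hx'⟩
    have hdis : ∀ y ∈ ball x r, y ∉ frontier E := by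
      intro y hy hyf
      exact hx' (mem_thickening_iff.2 ⟨y, hyf, by rwa [mem_ball'] at hy⟩)
    have hxi : x ∈ interior E := by
      by_contra h
      exact hdis x (mem_ball_self hr) ⟨hx, h⟩
    refine (convex_ball x r).isPreconnected.subset_left_of_subset_union isOpen_interior
      (isClosed_closure (s := E)).isOpen_compl ?_ ?_ ⟨x, mem_ball_self hr, hxi⟩
    · exact disjoint_compl_right.mono_left (interior_subset.trans subset_closure)
    · intro y hy
      by_cases h : y ∈ closure E
      · left
        by_contra h2
        exact hdis y hy ⟨h, h2⟩
      · right; exact h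
  have hAv : volume A ≤ volume (ball (0 : EuclideanSpace ℝ (Fin n)) (unitRadius n - r)) := by
    by_contra hcon
    push Not at hcon
    set b := max (unitRadius n - r) 0 with hb
    have hbv : volume (ball (0 : EuclideanSpace ℝ (Fin n)) (unitRadius n - r)) =
        ENNReal.ofReal (b ^ n) * volume (ball (0 : EuclideanSpace ℝ (Fin n)) 1) := by
      rcases le_total (unitRadius n - r) 0 with h | h
      · rw [hb, max_eq_right h, ball_eq_empty.2 h]
        simp [show n ≠ 0 by omega]
      · rw [hb, max_eq_left h, vol_ball_nonneg hn _ h]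
    have hcont : Continuous fun a : ℝ =>
        ENNReal.ofReal (a ^ n) * volume (ball (0 : EuclideanSpace ℝ (Fin n)) 1) :=
      (ENNReal.continuous_mul_const unit_ball_ne_top).comp
        (ENNReal.continuous_ofReal.comp (continuous_pow n))
    rw [hbv] at hcon
    have hev := (hcont.tendsto b).eventually (gt_mem_nhds hcon)
    obtain ⟨a, ha1, ha2⟩ := ((hev.filter_mono nhdsWithin_le_nhds).and
      (self_mem_nhdsWithin (s := Ioi b))).exists
    have ha0 : 0 < a := lt_of_le_of_lt (le_max_right _ _) ha2
    have har : unitRadius n - r < a := lt_of_le_of_lt (le_max_left _ _) ha2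
    rw [← vol_ball_pos 0 ha0] at ha1
    have := bm_add hAm (isOpen_interior (s := E)).measurableSet ha0 hr ha1.le (fun x hx y hy => by
      apply hball x hx
      rw [mem_ball_iff_norm]
      simpa using hy)
    have h2 : volume (interior E) ≤ 1 := h1 ▸ measure_mono interior_subset
    have h3 := le_of_vol_ball_le hn (by positivity) (unitRadius_pos n)
      (this.trans (h2.trans (vol_ball_unitRadius hn 0).ge))
    linarith
  refine (measure_mono ?_).trans ((measure_union_le (thickening r (frontier E)) A).trans
    (by gcongr))
  intro x hx
  by_cases hxc : x ∈ thickening r (frontier E)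
  · exact Or.inl hxc
  by_cases hxE : x ∈ closure E
  · exact Or.inr ⟨hxE, hxc⟩
  exfalso
  obtain ⟨y, hy, hxy⟩ := mem_thickening_iff.1 hx
  -- the ball around x meets E and the complement of closure E
  have : ball x r ⊆ (closure E)ᶜ := by
    refine (convex_ball x r).isPreconnected.subset_left_of_subset_union
      (isClosed_closure (s := E)).isOpen_compl (isOpen_interior (s := E)) ?_ ?_ ⟨x, mem_ball_self hr, hxE⟩
    · exact disjoint_compl_left.mono_right (interior_subset.trans subset_closure)
    · intro z hz
      by_cases h : z ∈ closure E
      · right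
        by_contra h2
        exact hxc (mem_thickening_iff.2 ⟨z, ⟨h, h2⟩, by rwa [mem_ball'] at hz⟩)
      · left; exact h
  exact this (by rwa [mem_ball'] ) (subset_closure hy)

theorem per_ball {n : ℕ} (hn : 2 ≤ n) {r : ℝ} (hr : 0 < r) :
    volume (minkSum n r (frontier (densityOnePoints n (ball 0 (unitRadius n))))) +
      volume (ball (0 : EuclideanSpace ℝ (Fin n)) (unitRadius n - r)) ≤
      volume (ball (0 : EuclideanSpace ℝ (Fin n)) (unitRadius n + r)) := by
  rw [frontier_density (convex_ball _ _) (vol_ball_unitRadius hn 0), minkSum_eq,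
    frontier_ball _ (unitRadius_pos n).ne', ← measure_union ?_ measurableSet_ball]
  · apply measure_mono
    apply union_subset
    · intro x hx
      obtain ⟨y, hy, hxy⟩ := mem_thickening_iff.1 hx
      rw [mem_sphere] at hy
      rw [mem_ball]
      linarith [dist_triangle x y 0]
    · exact ball_subset_ball (by linarith)
  · rw [Set.disjoint_left]
    intro x hx hx2
    obtain ⟨y, hy, hxy⟩ := mem_thickening_iff.1 hx
    rw [mem_sphere] at hy
    rw [mem_ball] at hx2
    linarith [dist_triangle y x 0, dist_comm x y]

theorem riesz_local {n : ℕ} (hn : 2 ≤ n) {α : ℝ} (hα : 0 < α) (hαn : α < n) (R : ℝ) :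
    ∫⁻ y in ball (0 : EuclideanSpace ℝ (Fin n)) R, ‖y‖ₑ ^ (-α) < ∞ := by
  haveI : NeZero n := ⟨by omega⟩
  haveI : Nontrivial (EuclideanSpace ℝ (Fin n)) := by
    apply Module.nontrivial_of_finrank_pos (R := ℝ)
    simp; omega
  have h1 : IntegrableOn (fun x : EuclideanSpace ℝ (Fin n) => ‖x‖ ^ (-α)) (ball 0 R) := by
    rw [integrableOn_fun_norm_addHaar (μ := volume) (f := fun t : ℝ => t ^ (-α))]
    have h2 : IntegrableOn (fun t : ℝ => t ^ ((n : ℝ) - 1 - α)) (Ioo 0 R) := by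
      rcases le_or_gt R 0 with h | h
      · simp [Ioo_eq_empty_of_le h]
      · rw [intervalIntegral.integrableOn_Ioo_rpow_iff h]; linarith
    refine h2.congr_fun ?_ measurableSet_Ioo
    intro t ht
    simp only [finrank_euclideanSpace_fin, smul_eq_mul]
    rw [← Real.rpow_natCast, ← Real.rpow_add ht.1]
    congr 1
    rw [Nat.cast_sub (by omega)]
    push_cast; ring
  refine lt_of_le_of_lt (lintegral_mono_ae ?_) h1.2
  have hne : ∀ᵐ x ∂(volume : Measure (EuclideanSpace ℝ (Fin n))), x ≠ 0 := by
    simp [ae_iff]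
  filter_upwards [ae_restrict_of_ae hne] with x hx
  have hp : 0 < ‖x‖ := norm_pos_iff.2 hx
  rw [← ofReal_norm_eq_enorm, ← ofReal_norm_eq_enorm, ENNReal.ofReal_rpow_of_pos hp,
    Real.norm_of_nonneg (by positivity)]

theorem riesz_ball {n : ℕ} (hn : 2 ≤ n) {α : ℝ} (hα : 0 < α) (hαn : α < n) {R : ℝ} :
    rieszEnergy n α (ball 0 R) < ∞ := by
  unfold rieszEnergy
  have hl := riesz_local hn hα hαn (2 * R)
  refine lt_of_le_of_lt (setLIntegral_mono' (g := fun _ =>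
    ∫⁻ y in ball (0 : EuclideanSpace ℝ (Fin n)) (2 * R), ‖y‖ₑ ^ (-α)) measurableSet_ball ?_) ?_
  · intro x hx
    rw [← lintegral_indicator measurableSet_ball, ← lintegral_indicator measurableSet_ball,
      ← lintegral_sub_left_eq_self _ x]
    refine lintegral_mono fun y => ?_
    by_cases hy : x - y ∈ ball (0 : EuclideanSpace ℝ (Fin n)) R
    · rw [indicator_of_mem hy, indicator_of_mem, edist_eq_enorm_sub, sub_sub_cancel]
      rw [mem_ball_zero_iff] at *
      have := norm_sub_le x (x - y)
      rw [sub_sub_cancel] at this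
      linarith
    · rw [indicator_of_notMem hy]; exact zero_le
  · rw [setLIntegral_const]
    exact ENNReal.mul_lt_top hl measure_ball_lt_top

theorem diam_bound {n : ℕ} {E : Set (EuclideanSpace ℝ (Fin n))} (hc : Convex ℝ E) {r : ℝ}
    (hr : 0 < r) {C : ℝ≥0∞} (hC : C ≠ ∞) (hv : volume (thickening r E) ≤ C)
    {x y : EuclideanSpace ℝ (Fin n)} (hx : x ∈ E) (hy : y ∈ E) :
    dist x y ≤ 2 * r * (C / volume (ball (0 : EuclideanSpace ℝ (Fin n)) r)).toReal := by
  set v := volume (ball (0 : EuclideanSpace ℝ (Fin n)) r) with hvdef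
  have hv0 : v ≠ 0 := (measure_ball_pos _ _ hr).ne'
  have hvt : v ≠ ∞ := measure_ball_lt_top.ne
  set D := dist x y with hD
  rcases (dist_nonneg (x := x) (y := y)).eq_or_lt with h0 | hpos
  · rw [hD, ← h0]; positivity
  rw [← hD] at hpos
  set N := ⌊D / (2 * r)⌋₊ with hN
  have hND : (N : ℝ) * (2 * r) ≤ D := by
    have := Nat.floor_le (a := D / (2 * r)) (by positivity)
    rwa [le_div_iff₀ (by positivity)] at this
  let p : ℕ → EuclideanSpace ℝ (Fin n) := fun i => AffineMap.lineMap x y ((i : ℝ) * (2 * r) / D)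
  have hpE : ∀ i ∈ Finset.range (N + 1), p i ∈ E := by
    intro i hi
    have hiN : (i : ℝ) ≤ N := by exact_mod_cast Nat.lt_succ_iff.1 (Finset.mem_range.1 hi)
    refine hc.lineMap_mem hx hy ⟨by positivity, ?_⟩
    rw [div_le_one hpos]
    refine le_trans ?_ hND
    gcongr
  have hdisj : ∀ i j : ℕ, i ≠ j → Disjoint (ball (p i) r) (ball (p j) r) := by
    intro i j hij
    apply ball_disjoint_ball
    rw [dist_lineMap_lineMap, ← hD, Real.dist_eq, ← sub_div, abs_div, abs_of_pos hpos,
      div_mul_cancel₀ _ hpos.ne', ← sub_mul, abs_mul, abs_of_pos (by positivity : 0 < 2 * r)]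
    have : (1 : ℝ) ≤ |(i : ℝ) - j| := by
      have : (1 : ℤ) ≤ |(i : ℤ) - j| := Int.one_le_abs (by omega)
      exact_mod_cast this
    nlinarith
  have hsum : ((N + 1 : ℕ) : ℝ≥0∞) * v ≤ C := by
    calc ((N + 1 : ℕ) : ℝ≥0∞) * v = ∑ i ∈ Finset.range (N + 1), volume (ball (p i) r) := by
          simp [hvdef, Measure.addHaar_ball_center]
      _ = volume (⋃ i ∈ Finset.range (N + 1), ball (p i) r) :=
          (measure_biUnion_finset (fun i _ j _ hij => hdisj i j hij)
            (fun i _ => measurableSet_ball)).symm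
      _ ≤ volume (thickening r E) := by
          apply measure_mono
          refine iUnion₂_subset fun i hi => ?_
          exact ball_subset_thickening (hpE i hi) r
      _ ≤ C := hv
  have h2 : ((N + 1 : ℕ) : ℝ≥0∞) ≤ C / v := by
    rwa [ENNReal.le_div_iff_mul_le (Or.inl hv0) (Or.inl hvt)]
  have h3 := ENNReal.toReal_mono (ENNReal.div_ne_top hC hv0) h2
  simp only [ENNReal.toReal_natCast] at h3
  have h4 : D / (2 * r) < N + 1 := Nat.lt_floor_add_one _
  rw [div_lt_iff₀ (by positivity)] at h4
  push_cast at h3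
  nlinarith

theorem exists_radius {n : ℕ} (hn : 2 ≤ n) {A : Set (EuclideanSpace ℝ (Fin n))} {b : ℝ}
    (hb : 0 ≤ b) (h : volume (ball (0 : EuclideanSpace ℝ (Fin n)) b) < volume A) :
    ∃ a, b < a ∧ volume (ball (0 : EuclideanSpace ℝ (Fin n)) a) ≤ volume A := by
  have hcont : Continuous fun a : ℝ =>
      ENNReal.ofReal (a ^ n) * volume (ball (0 : EuclideanSpace ℝ (Fin n)) 1) :=
    (ENNReal.continuous_mul_const unit_ball_ne_top).comp
      (ENNReal.continuous_ofReal.comp (continuous_pow n))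
  rw [vol_ball_nonneg hn _ hb] at h
  have hev := (hcont.tendsto b).eventually (gt_mem_nhds h)
  obtain ⟨a, ha1, ha2⟩ := ((hev.filter_mono nhdsWithin_le_nhds).and
    (self_mem_nhdsWithin (s := Ioi b))).exists
  refine ⟨a, ha2, ?_⟩
  rw [vol_ball_pos _ (lt_of_le_of_lt hb ha2)]
  exact ha1.le

theorem vol_thickening_le {n : ℕ} {r : ℝ} {K : Set (EuclideanSpace ℝ (Fin n))}
    {V : ℝ≥0∞} (h : ∀ δ, 0 < δ → volume (thickening (r - δ) K) ≤ V) :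
    volume (thickening r K) ≤ V := by
  have e : thickening r K = ⋃ j : ℕ, thickening (r - 1 / ((j : ℝ) + 1)) K := by
    apply Subset.antisymm
    · intro x hx
      obtain ⟨z, hz, hxz⟩ := mem_thickening_iff.1 hx
      obtain ⟨j, hj⟩ := exists_nat_one_div_lt (sub_pos.2 hxz)
      exact mem_iUnion.2 ⟨j, mem_thickening_iff.2 ⟨z, hz, by linarith⟩⟩
    · refine iUnion_subset fun j => thickening_mono ?_ _
      have : 0 < 1 / ((j : ℝ) + 1) := by positivity
      linarith
  have hmono : Monotone fun j : ℕ => thickening (r - 1 / ((j : ℝ) + 1)) K := by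
    intro i j hij
    refine thickening_mono ?_ _
    have := Nat.one_div_le_one_div (α := ℝ) hij
    linarith
  rw [e, hmono.measure_iUnion]
  exact iSup_le fun j => h _ (by positivity)

theorem limit_is_ball {n : ℕ} (hn : 2 ≤ n) {r : ℝ} (hr : 0 < r)
    {K : Set (EuclideanSpace ℝ (Fin n))} (hK : IsCompact K) (hKc : Convex ℝ K)
    (h1 : 1 ≤ volume K)
    (hV : volume (thickening r K) ≤
      volume (ball (0 : EuclideanSpace ℝ (Fin n)) (unitRadius n + r))) :
    ∃ z, K = closedBall z (unitRadius n) := by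
  set R := unitRadius n with hRdef
  have hR : 0 < R := unitRadius_pos n
  have hB : volume (ball (0 : EuclideanSpace ℝ (Fin n)) R) = 1 := vol_ball_unitRadius hn 0
  have hKle : volume K ≤ 1 := by
    by_contra hcon
    push Not at hcon
    rw [← hB] at hcon
    obtain ⟨a, ha, hav⟩ := exists_radius hn hR.le hcon
    have := bm_add hK.measurableSet (isOpen_thickening (δ := r) (E := K)).measurableSet
      (hR.trans ha) hr hav (fun x hx y hy => mem_thickening_iff.2 ⟨x, hx, by
        rw [mem_ball_zero_iff] at hy; simpa using hy⟩)
    have := le_of_vol_ball_le hn (by linarith) (by positivity) (this.trans hV)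
    linarith
  have hl0 : 0 < r / (R + r) := by positivity
  have hl1 : r / (R + r) < 1 := by rw [div_lt_one (by positivity)]; linarith
  refine bm_equality hK hKc (le_antisymm hKle h1) hR hB
    (M := (R / (R + r)) • thickening r K)
    ((isOpen_thickening (δ := r) (E := K)).measurableSet.const_smul_of_ne_zero (by positivity))
    ?_ hl0 hl1 ?_
  · calc volume ((R / (R + r)) • thickening r K)
        ≤ volume ((R / (R + r)) • ball (0 : EuclideanSpace ℝ (Fin n)) (R + r)) := by
          rw [Measure.addHaar_smul, Measure.addHaar_smul]
          gcongr
      _ = 1 := by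
          rw [_root_.smul_ball (by positivity), smul_zero, Real.norm_of_nonneg (by positivity),
            div_mul_cancel₀ _ (by positivity), hB]
  · intro x hx y hy
    refine ⟨x + (r / R) • y, mem_thickening_iff.2 ⟨x, hx, ?_⟩, ?_⟩
    · rw [mem_ball_zero_iff] at hy
      rw [dist_eq_norm, add_sub_cancel_left, norm_smul, Real.norm_of_nonneg (by positivity),
        div_mul_eq_mul_div, div_lt_iff₀ hR]
      gcongr
    · simp only [smul_add, smul_smul]
      congr 2 <;> field_simp
      ring

theorem seq_stability {n : ℕ} (hn : 2 ≤ n) {r : ℝ} (hr : 0 < r) {D : ℝ}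
    (C : ℕ → TopologicalSpace.NonemptyCompacts (EuclideanSpace ℝ (Fin n)))
    (hD : ∀ k, (C k : Set (EuclideanSpace ℝ (Fin n))) ⊆ closedBall 0 D)
    (hc : ∀ k, Convex ℝ (C k : Set (EuclideanSpace ℝ (Fin n))))
    (h1 : ∀ k, 1 ≤ volume (C k : Set (EuclideanSpace ℝ (Fin n))))
    (hV : ∀ k, volume (thickening r (C k : Set (EuclideanSpace ℝ (Fin n)))) ≤
      volume (ball (0 : EuclideanSpace ℝ (Fin n)) (unitRadius n + r)) +
        ENNReal.ofReal (1 / ((k : ℝ) + 1))) {ε : ℝ} (hε : 0 < ε) :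
    ∃ k z, hausdorffDist (C k : Set (EuclideanSpace ℝ (Fin n))) (closedBall z (unitRadius n)) < ε := by
  obtain ⟨K, -, φ, hφ, hlim⟩ :=
    (TopologicalSpace.NonemptyCompacts.isCompact_subsets_of_isCompact
      (isCompact_closedBall (0 : EuclideanSpace ℝ (Fin n)) D)).tendsto_subseq (x := C) hD
  have hdist : ∀ δ, 0 < δ → ∀ᶠ k in atTop,
      hausdorffDist (C (φ k) : Set (EuclideanSpace ℝ (Fin n))) (K : Set _) < δ := by
    intro δ hδ
    filter_upwards [(Metric.tendsto_nhds.1 hlim) δ hδ] with k hk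
    exact hk
  have hfin : ∀ k, hausdorffEDist (C (φ k) : Set (EuclideanSpace ℝ (Fin n))) (K : Set _) ≠ ∞ :=
    fun k => hausdorffEDist_ne_top_of_nonempty_of_bounded (C (φ k)).nonempty K.nonempty
      (C (φ k)).isCompact.isBounded K.isCompact.isBounded
  have hs1 : ∀ δ, 0 < δ → ∀ᶠ k in atTop,
      (C (φ k) : Set (EuclideanSpace ℝ (Fin n))) ⊆ thickening δ (K : Set _) := by
    intro δ hδ
    filter_upwards [hdist δ hδ] with k hk x hx
    obtain ⟨y, hy, hxy⟩ := exists_dist_lt_of_hausdorffDist_lt hx hk (hfin k)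
    exact mem_thickening_iff.2 ⟨y, hy, hxy⟩
  have hs2 : ∀ δ, 0 < δ → ∀ᶠ k in atTop,
      (K : Set (EuclideanSpace ℝ (Fin n))) ⊆ thickening δ (C (φ k) : Set _) := by
    intro δ hδ
    filter_upwards [hdist δ hδ] with k hk x hx
    obtain ⟨y, hy, hxy⟩ := exists_dist_lt_of_hausdorffDist_lt' hx hk (hfin k)
    exact mem_thickening_iff.2 ⟨y, hy, by rwa [dist_comm]⟩
  have hKc : Convex ℝ (K : Set (EuclideanSpace ℝ (Fin n))) := by
    intro x hx y hy a b ha hb hab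
    rw [← K.isCompact.isClosed.closure_eq, Metric.mem_closure_iff]
    intro δ hδ
    obtain ⟨k, hk1, hk2⟩ := ((hs1 (δ / 2) (by positivity)).and (hs2 (δ / 2) (by positivity))).exists
    obtain ⟨c, hcC, hcd⟩ := mem_thickening_iff.1
      (((hc (φ k)).thickening (δ / 2)) (hk2 hx) (hk2 hy) ha hb hab)
    obtain ⟨d, hd, hdc⟩ := mem_thickening_iff.1 (hk1 hcC)
    exact ⟨d, hd, by linarith [dist_triangle (a • x + b • y) c d]⟩
  have hK1 : 1 ≤ volume (K : Set (EuclideanSpace ℝ (Fin n))) := by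
    refine ge_of_tendsto (tendsto_measure_thickening_of_isClosed
      ⟨1, one_pos, K.isCompact.isBounded.thickening.measure_lt_top.ne⟩ K.isCompact.isClosed) ?_
    filter_upwards [self_mem_nhdsWithin] with δ hδ
    obtain ⟨k, hk⟩ := (hs1 δ hδ).exists
    exact (h1 (φ k)).trans (measure_mono hk)
  have hKV : volume (thickening r (K : Set (EuclideanSpace ℝ (Fin n)))) ≤
      volume (ball (0 : EuclideanSpace ℝ (Fin n)) (unitRadius n + r)) := by
    refine vol_thickening_le fun δ hδ => ?_
    have hlim2 : Tendsto (fun k : ℕ => volume (ball (0 : EuclideanSpace ℝ (Fin n)) (unitRadius n + r)) +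
        ENNReal.ofReal (1 / ((φ k : ℝ) + 1))) atTop
        (nhds (volume (ball (0 : EuclideanSpace ℝ (Fin n)) (unitRadius n + r)) + 0)) := by
      refine Tendsto.const_add _ ?_
      rw [← ENNReal.ofReal_zero]
      exact (ENNReal.continuous_ofReal.tendsto 0).comp
        (tendsto_one_div_add_atTop_nhds_zero_nat.comp hφ.tendsto_atTop)
    rw [add_zero] at hlim2
    refine ge_of_tendsto hlim2 ?_
    filter_upwards [hs2 δ hδ] with k hk
    refine le_trans (measure_mono ?_) (hV (φ k))
    refine (thickening_subset_of_subset _ hk).trans ((thickening_thickening_subset _ _ _).trans ?_)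
    rw [sub_add_cancel]
  obtain ⟨z, hz⟩ := limit_is_ball hn hr K.isCompact hKc hK1 hKV
  obtain ⟨k, hk⟩ := (hdist ε hε).exists
  exact ⟨φ k, z, hz ▸ hk⟩

theorem stability {n : ℕ} (hn : 2 ≤ n) {r : ℝ} (hr : 0 < r) {ε : ℝ} (hε : 0 < ε) :
    ∃ δ : ℝ, 0 < δ ∧ ∀ E : Set (EuclideanSpace ℝ (Fin n)), IsBounded E → Convex ℝ E →
      volume E = 1 → volume (thickening r E) ≤
        volume (ball (0 : EuclideanSpace ℝ (Fin n)) (unitRadius n + r)) + ENNReal.ofReal δ →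
      ∃ x, hausdorffDist E (ball x (unitRadius n)) < ε := by
  by_contra hcon
  push Not at hcon
  choose! E hEb hEc hE1 hEV hEd using fun k : ℕ => hcon (1 / ((k : ℝ) + 1)) (by positivity)
  have hne : ∀ k, (E k).Nonempty := fun k =>
    (interior_nonempty_of_vol (hEc k) (hE1 k)).mono interior_subset
  choose p hp using hne
  let S : ℕ → Set (EuclideanSpace ℝ (Fin n)) := fun k => (fun x => -p k + x) '' E k
  have hvol : ∀ k (A : Set (EuclideanSpace ℝ (Fin n))), volume ((fun x => -p k + x) '' A) = volume A := by
    intro k A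
    rw [image_add_left, measure_preimage_add]
  have hSth : ∀ k, thickening r (S k) = (fun x => -p k + x) '' thickening r (E k) := by
    intro k
    ext x
    simp only [mem_thickening_iff, S, mem_image]
    constructor
    · rintro ⟨_, ⟨y, hy, rfl⟩, h⟩
      exact ⟨p k + x, ⟨y, hy, by rw [← dist_add_left (- p k)]; simpa using h⟩, by simp⟩
    · rintro ⟨x, ⟨y, hy, h⟩, rfl⟩
      exact ⟨_, ⟨y, hy, rfl⟩, by simpa using h⟩
  set V := volume (ball (0 : EuclideanSpace ℝ (Fin n)) (unitRadius n + r)) with hVdef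
  have hSD : ∃ D, ∀ k, S k ⊆ closedBall 0 D := by
    refine ⟨2 * r * ((V + 1) / volume (ball (0 : EuclideanSpace ℝ (Fin n)) r)).toReal, fun k => ?_⟩
    rintro _ ⟨x, hx, rfl⟩
    rw [mem_closedBall_zero_iff]
    have := diam_bound (hEc k) hr (C := V + 1)
      (ENNReal.add_ne_top.2 ⟨measure_ball_lt_top.ne, ENNReal.one_ne_top⟩) ?_ hx (hp k)
    · rwa [dist_eq_norm, sub_eq_neg_add] at this
    · refine (hEV k).trans ?_
      gcongr
      rw [← ENNReal.ofReal_one]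
      apply ENNReal.ofReal_le_ofReal
      rw [div_le_one (by positivity)]
      linarith [(Nat.cast_nonneg k : (0 : ℝ) ≤ k)]
  obtain ⟨D, hSD⟩ := hSD
  have hSc : ∀ k, Convex ℝ (S k) := fun k => (hEc k).translate _
  let C : ℕ → TopologicalSpace.NonemptyCompacts (EuclideanSpace ℝ (Fin n)) := fun k =>
    ⟨⟨closure (S k), (isBounded_closedBall.subset (hSD k)).isCompact_closure⟩,
      (Set.Nonempty.image _ ⟨p k, hp k⟩).closure⟩
  have hC : ∀ k, (C k : Set (EuclideanSpace ℝ (Fin n))) = closure (S k) := fun k => rfl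
  obtain ⟨k, z, hk⟩ := seq_stability hn hr (D := D) C
    (fun k => closure_minimal (hSD k) isClosed_closedBall)
    (fun k => (hSc k).closure)
    (fun k => by
      rw [hC]
      exact ((hvol k _).trans (hE1 k)).ge.trans (measure_mono subset_closure))
    (fun k => by
      rw [hC, thickening_closure, hSth, hvol]
      exact hEV k) hε
  refine absurd (hEd k (p k + z)) (not_le.2 ?_)
  have hiso : Isometry (fun x => -p k + x) := isometry_add_left _
  rw [hC, ← closure_ball z (unitRadius_pos n).ne', hausdorffDist_closure] at hk
  rw [← hausdorffDist_image hiso]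
  have hb : (fun x => -p k + x) '' ball (p k + z) (unitRadius n) = ball z (unitRadius n) := by
    rw [image_add_left, preimage_add_ball]
    simp
  rw [hb]
  exact hk

/-- Hausdorff convergence of rescaled minimizers to the unit-volume ball
as the volume tends to zero. -/
theorem minimizer_hausdorff_convergence (n : ℕ) (hn : 2 ≤ n) (α r : ℝ) (hα : 0 < α)
    (hαn : α < n) (hr : 0 < r) :
    ∀ ε : ℝ, 0 < ε →
      ∃ m₀ : ℝ, 0 < m₀ ∧
        ∀ (m : ℝ) (E : Set (EuclideanSpace ℝ (Fin n))), 0 < m → m < m₀ →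
          IsBounded E → Convex ℝ E → volume E = 1 →
          (∀ F : Set (EuclideanSpace ℝ (Fin n)), IsBounded F → Convex ℝ F → volume F = 1 →
            perR n r E + ENNReal.ofReal (m ^ (((n : ℝ) + 1 - α) / n)) * rieszEnergy n α E ≤
              perR n r F + ENNReal.ofReal (m ^ (((n : ℝ) + 1 - α) / n)) * rieszEnergy n α F) →
          ∃ x : EuclideanSpace ℝ (Fin n),
            Metric.hausdorffDist E (ball x (unitRadius n)) < ε := by
  intro ε hε
  obtain ⟨δ, hδ, hstab⟩ := stability hn hr hε
  set p := ((n : ℝ) + 1 - α) / n with hp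
  have hp0 : 0 < p := by
    have : 0 < (n : ℝ) := by positivity
    exact div_pos (by linarith) this
  have hΦ : rieszEnergy n α (ball 0 (unitRadius n)) ≠ ∞ := (riesz_ball hn hα hαn).ne
  set Φ := rieszEnergy n α (ball 0 (unitRadius n)) with hΦdef
  have hr2 : ENNReal.ofReal (2 * r) ≠ 0 := (ENNReal.ofReal_pos.2 (by positivity)).ne'
  have hlim : Tendsto (fun m : ℝ => m ^ p * (2 * r * Φ.toReal)) (nhdsWithin 0 (Ioi 0)) (nhds 0) := by
    have h1 : Tendsto (fun m : ℝ => m ^ p) (nhds 0) (nhds ((0 : ℝ) ^ p)) :=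
      (Real.continuousAt_rpow_const 0 p (Or.inr hp0.le)).tendsto
    rw [Real.zero_rpow hp0.ne'] at h1
    have := (h1.mul_const (2 * r * Φ.toReal)).mono_left (nhdsWithin_le_nhds (s := Ioi 0))
    rwa [zero_mul] at this
  obtain ⟨m₀, hm₀, hm₀'⟩ := (mem_nhdsGT_iff_exists_Ioo_subset).1
    (hlim.eventually (gt_mem_nhds hδ))
  refine ⟨m₀, hm₀, fun m E hm hmm hEb hEc hE1 hmin => ?_⟩
  apply hstab E hEb hEc hE1
  have hmd : m ^ p * (2 * r * Φ.toReal) < δ := hm₀' ⟨hm, hmm⟩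
  have hB := hmin (ball 0 (unitRadius n)) isBounded_ball (convex_ball _ _) (vol_ball_unitRadius hn 0)
  have hB' : perR n r E ≤ perR n r (ball 0 (unitRadius n)) + ENNReal.ofReal (m ^ p) * Φ :=
    le_self_add.trans hB
  have hmul : ∀ F, ENNReal.ofReal (2 * r) * perR n r F =
      volume (minkSum n r (frontier (densityOnePoints n F))) := fun F =>
    ENNReal.mul_div_cancel hr2 ENNReal.ofReal_ne_top
  have h3 : volume (minkSum n r (frontier (densityOnePoints n E))) ≤
      volume (minkSum n r (frontier (densityOnePoints n (ball 0 (unitRadius n))))) +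
        ENNReal.ofReal δ := by
    rw [← hmul, ← hmul]
    refine (mul_le_mul_right hB' _).trans ?_
    rw [mul_add]
    gcongr
    rw [← ENNReal.ofReal_toReal hΦ, ← ENNReal.ofReal_mul (by positivity),
      ← ENNReal.ofReal_mul (by positivity)]
    apply ENNReal.ofReal_le_ofReal
    linarith
  calc volume (thickening r E) ≤ _ := per_lower hn hr hEc hE1
    _ ≤ (volume (minkSum n r (frontier (densityOnePoints n (ball 0 (unitRadius n))))) +
        ENNReal.ofReal δ) + volume (ball (0 : EuclideanSpace ℝ (Fin n)) (unitRadius n - r)) := by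
          gcongr
    _ = (volume (minkSum n r (frontier (densityOnePoints n (ball 0 (unitRadius n))))) +
        volume (ball (0 : EuclideanSpace ℝ (Fin n)) (unitRadius n - r))) + ENNReal.ofReal δ := by
          ring
    _ ≤ _ := by
          gcongr
          exact per_ball hn hr
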